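/- arXiv:math/0409584 — 2 statements merged into one kernel-verified Lean document; each statement's English description precedes it below -/
import Mathlib

section
/- Let P and Q be fine saturated monoids, and suppose there exist an integer N > 0 and monoid morphisms f: P → Q and g: Q → P such that g(f(x)) = x^N for every x ∈ P. If R is a noetherian ring such that R[Q] is Cohen–Macaulay, then R[P] is Cohen–Macaulay. -/
/-- A noetherian local ring is Cohen–Macaulay if its maximal ideal contains a regular
sequence of length equal to its Krull dimension (i.e. depth = dimension). -/
def IsCohenMacaulayLocalRing (R : Type*) [CommRing R] [IsLocalRing R] : Prop :=
  ∃ rs : List R, (∀ x ∈ rs, x ∈ IsLocalRing.maximalIdeal R) ∧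
    RingTheory.Sequence.IsRegular R rs ∧ (rs.length : WithBot (WithTop ℕ)) = ringKrullDim R

/-- A (noetherian) commutative ring is Cohen–Macaulay if all its localizations at prime
ideals are Cohen–Macaulay local rings. -/
def IsCohenMacaulayRing (R : Type*) [CommRing R] : Prop :=
  ∀ p : Ideal R, ∀ hp : p.IsPrime,
    letI := hp
    IsCohenMacaulayLocalRing (Localization.AtPrime p)

/-- A commutative monoid is saturated if it is root-closed in its groupification: whenever
`aⁿ` is divisible by `bⁿ` (for some `n ≥ 1`), `a` is divisible by `b`. -/
def IsSaturatedMonoid (P : Type*) [CommMonoid P] : Prop :=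
  ∀ a b : P, ∀ n : ℕ, 0 < n → (∃ c, a ^ n = b ^ n * c) → ∃ d, a = b * d


section
namespace HCM
open CategoryTheory Abelian RingTheory.Sequence Limits
open scoped Pointwise
universe u

/-- Vanishing of `Ext^i(N, M)` for `i < n`. -/
def DP {Λ : Type u} [CommRing Λ] (N : ModuleCat.{u} Λ) (n : ℕ) (M : Type u) [AddCommGroup M]
    [Module Λ M] : Prop :=
  ∀ i < n, Subsingleton (Ext N (ModuleCat.of Λ M) i)

section
variable {Λ : Type u} [CommRing Λ] (N : ModuleCat.{u} Λ)
variable {M M' K : Type u} [AddCommGroup M] [Module Λ M] [AddCommGroup M'] [Module Λ M']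
  [AddCommGroup K] [Module Λ K]

lemma shortExact_of {f : M →ₗ[Λ] M'} {g : M' →ₗ[Λ] K} (hf : Function.Injective f)
    (hg : Function.Surjective g) (h : Function.Exact f g) :
    (ShortComplex.mk (ModuleCat.ofHom f) (ModuleCat.ofHom g)
      (by ext x; exact h.apply_apply_eq_zero x)).ShortExact where
  exact := (ShortComplex.ShortExact.moduleCat_exact_iff_function_exact _).mpr h
  mono_f := (ModuleCat.mono_iff_injective _).mpr hf
  epi_g := (ModuleCat.epi_iff_surjective _).mpr hg

variable {N}

lemma DP.ses {n : ℕ} {f : M →ₗ[Λ] M'} {g : M' →ₗ[Λ] K} (hf : Function.Injective f)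
    (hg : Function.Surjective g) (h : Function.Exact f g) (h1 : DP N n M) (h3 : DP N n K) :
    DP N n M' := by
  intro i hi
  have hS := shortExact_of hf hg h
  have e := Ext.covariant_sequence_exact₂' N hS i
  have zero1 := AddCommGrpCat.isZero_of_iff_subsingleton.mpr (h1 i hi)
  have zero2 := AddCommGrpCat.isZero_of_iff_subsingleton.mpr (h3 i hi)
  exact AddCommGrpCat.subsingleton_of_isZero <| ShortComplex.Exact.isZero_of_both_zeros e
        (zero1.eq_zero_of_src _) (zero2.eq_zero_of_tgt _)

lemma DP.of_subsingleton {n : ℕ} [Subsingleton M] : DP N n M := by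
  intro i hi
  have hz : IsZero (ModuleCat.of Λ M) := ModuleCat.isZero_of_subsingleton _
  have h0 : 𝟙 (ModuleCat.of Λ M) = 0 := hz.eq_of_src _ _
  have key : ∀ a : Abelian.Ext N (ModuleCat.of Λ M) i, a = 0 := by
    intro a
    rw [← Abelian.Ext.comp_mk₀_id a, h0, Abelian.Ext.mk₀_zero, Abelian.Ext.comp_zero]
  exact ⟨fun a b => by rw [key a, key b]⟩

lemma DP.equiv {n : ℕ} (e : M ≃ₗ[Λ] M') (h1 : DP N n M) : DP N n M' := by
  refine DP.ses (f := e.toLinearMap) (g := (0 : M' →ₗ[Λ] PUnit.{u+1})) e.injective ?_ ?_ h1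
    DP.of_subsingleton
  · exact fun x => ⟨0, Subsingleton.elim _ _⟩
  · intro y; simp

lemma DP.reg {n : ℕ} {x : Λ} (hx : IsSMulRegular M x) (hN : x ∈ Module.annihilator Λ N)
    (h : DP N n (QuotSMulTop x M)) : DP N (n+1) M := by
  intro i hi
  have hS := hx.smulShortComplex_shortExact (M := ModuleCat.of Λ M)
  let g := (AddCommGrpCat.ofHom ((Ext.mk₀ ((ModuleCat.of Λ M).smulShortComplex x).f).postcomp N
          (add_zero i)))
  have mono_g : Mono g := by
    revert g
    rcases i with _ | i
    · intro g
      have := hS.mono_f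
      exact Ext.mono_postcomp_mk₀_of_mono _ _
    · intro g
      exact (Ext.covariant_sequence_exact₁' N hS i (i + 1) rfl).mono_g
        ((AddCommGrpCat.isZero_of_iff_subsingleton.mpr (h i (by omega))).eq_zero_of_src _)
  have zero_g : g = 0 := Ext.postcomp_smul_id_eq_zero_of_mem_annihilator hN i
  exact AddCommGrpCat.subsingleton_of_isZero (IsZero.of_mono_eq_zero _ zero_g)

lemma DP.quot {n : ℕ} {x : Λ} (hx : IsSMulRegular M x)
    (h : DP N (n+1) M) : DP N n (QuotSMulTop x M) := by
  intro i hi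
  have hS := hx.smulShortComplex_shortExact (M := ModuleCat.of Λ M)
  have zero1 := AddCommGrpCat.isZero_of_iff_subsingleton.mpr (h i (by omega))
  have zero2 := AddCommGrpCat.isZero_of_iff_subsingleton.mpr (h (i + 1) (by omega))
  exact AddCommGrpCat.subsingleton_of_isZero <| ShortComplex.Exact.isZero_of_both_zeros
    ((Ext.covariant_sequence_exact₃' N hS) i (i + 1) rfl)
    (zero1.eq_zero_of_src _) (zero2.eq_zero_of_tgt _)

lemma DP.mono {m n : ℕ} (h : m ≤ n) (h1 : DP N n M) : DP N m M := fun i hi => h1 i (by omega)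

/-- Injective endomorphism by a monomial, phrased with a linear map onto the quotient. -/
lemma DP.reg' {n : ℕ} {x : Λ} (hx : IsSMulRegular M x) (hN : x ∈ Module.annihilator Λ N)
    {g : M →ₗ[Λ] K} (hg : Function.Surjective g) (hk : ∀ m, g m = 0 ↔ ∃ m', x • m' = m)
    (h : DP N n K) : DP N (n+1) M := by
  have hker : (x • (⊤ : Submodule Λ M)) = LinearMap.ker g := by
    ext m
    rw [LinearMap.mem_ker, hk, Submodule.mem_smul_pointwise_iff_exists]
    simp
  refine DP.reg hx hN (DP.equiv (M := K) ?_ h)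
  exact ((Submodule.quotEquivOfEq _ _ hker).trans (g.quotKerEquivOfSurjective hg)).symm

lemma DP.list_reg {n : ℕ} (rs : List Λ) (hr : ∀ r ∈ rs, r ∈ Module.annihilator Λ N)
    (hreg : IsWeaklyRegular M rs)
    (h : DP N n (M ⧸ (Ideal.ofList rs • ⊤ : Submodule Λ M))) : DP N (rs.length + n) M := by
  induction rs generalizing M with
  | nil =>
    simp only [List.length_nil, zero_add]
    refine DP.equiv ?_ h
    exact Submodule.quotEquivOfEqBot _ (by simp)
  | cons r rs ih =>
    rw [isWeaklyRegular_cons_iff] at hreg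
    have := ih (M := QuotSMulTop r M) (fun s hs => hr s (by simp [hs])) hreg.2
      (DP.equiv (Submodule.quotOfListConsSMulTopEquivQuotSMulTopInner M r rs) h)
    have h2 := DP.reg hreg.1 (hr r (by simp)) this
    exact DP.mono (by simp; omega) h2

lemma DP.list_quot {n : ℕ} (rs : List Λ) (hreg : IsWeaklyRegular M rs)
    (h : DP N (rs.length + n) M) : DP N n (M ⧸ (Ideal.ofList rs • ⊤ : Submodule Λ M)) := by
  induction rs generalizing M with
  | nil =>
    refine DP.equiv ?_ (DP.mono (by simp) h)
    exact (Submodule.quotEquivOfEqBot _ (by simp)).symm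
  | cons r rs ih =>
    rw [isWeaklyRegular_cons_iff] at hreg
    have h2 := DP.quot (n := rs.length + n) hreg.1 (DP.mono (by rw [List.length_cons]; omega) h)
    exact DP.equiv (Submodule.quotOfListConsSMulTopEquivQuotSMulTopInner M r rs).symm
      (ih hreg.2 h2)

/-- Rees, producing a regular sequence. -/
lemma DP.exists_regular [IsNoetherianRing Λ] (I : Ideal Λ) (hI : I ≠ ⊤) {n : ℕ}
    (h : DP (ModuleCat.of Λ (Λ ⧸ I)) n Λ) :
    ∃ rs : List Λ, rs.length = n ∧ (∀ r ∈ rs, r ∈ I) ∧ IsRegular Λ rs := by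
  refine ModuleCat.exists_isRegular_of_exists_subsingleton_ext I n (ModuleCat.of Λ Λ) ?_
    (ModuleCat.of Λ (Λ ⧸ I)) ?_ h
  · rw [lt_top_iff_ne_top]; simpa using hI
  · rw [Module.support_eq_zeroLocus, Ideal.annihilator_quotient]

lemma DP.of_regular [IsNoetherianRing Λ] (I : Ideal Λ) (hI : I ≠ ⊤)
    (rs : List Λ) (hrs : ∀ r ∈ rs, r ∈ I) (h : IsRegular Λ rs) :
    DP (ModuleCat.of Λ (Λ ⧸ I)) rs.length Λ := by
  refine ModuleCat.subsingleton_ext_of_exists_isRegular I _ ?_ (ModuleCat.of Λ Λ) ?_ rs hrs h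
  · rw [Module.support_eq_zeroLocus, Ideal.annihilator_quotient]
  · rw [lt_top_iff_ne_top]; simpa using hI

lemma DP.hom_eq_zero {n : ℕ} (hn : 0 < n) (h : DP N n M) (f : N →ₗ[Λ] M) : f = 0 := by
  have : Subsingleton (N ⟶ ModuleCat.of Λ M) := Ext.addEquiv₀.subsingleton_congr.mp (h 0 hn)
  have : Subsingleton (N →ₗ[Λ] M) := (ModuleCat.homAddEquiv (M := N) (N := ModuleCat.of Λ M)).symm.subsingleton
  exact Subsingleton.elim _ _

end
end HCM
end

section
namespace HCM
open RingTheory.Sequence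
open scoped Pointwise
universe u

section conic
variable {L : Type} [AddCommGroup L]

/-- Subsets of `L` which are convex for the order defined by `P`. -/
structure CSet (P : AddSubmonoid L) where
  carrier : Set L
  conv : ∀ p q r, p ∈ carrier → q ∈ P → r ∈ P → p + q + r ∈ carrier → p + q ∈ carrier

variable (A : Type u) [CommRing A] (C : Type u) [AddCommGroup C] [Module A C]

/-- Translate by `q` and restrict to `S`. -/
noncomputable def tr (S : Set L) (q : L) : (L →₀ C) →ₗ[A] Finsupp.supported C A S := by
  classical
  exact (Finsupp.restrictDom C A S).comp (Finsupp.lmapDomain C A (fun x => x + q))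

open Classical in
lemma tr_apply (S : Set L) (q : L) (f : L →₀ C) (x : L) :
    (tr A C S q f : L →₀ C) x = if x ∈ S then f (x - q) else 0 := by
  have : Finsupp.mapDomain (fun x => x + q) f x = f (x - q) := by
    conv_lhs => rw [← sub_add_cancel x q]
    exact Finsupp.mapDomain_apply (add_left_injective q) f (x - q)
  simp only [tr, LinearMap.comp_apply, Finsupp.lmapDomain_apply]
  rw [Finsupp.restrictDom_apply, Finsupp.filter_apply, this]

/-- The conic module attached to a convex set. -/
def CMod {P : AddSubmonoid L} (S : CSet P) : Type u := Finsupp.supported C A S.carrier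

variable {P : AddSubmonoid L} (S S' : CSet P)

noncomputable instance : AddCommGroup (CMod A C S) :=
  inferInstanceAs (AddCommGroup (Finsupp.supported C A S.carrier))
noncomputable instance : Module A (CMod A C S) :=
  inferInstanceAs (Module A (Finsupp.supported C A S.carrier))

variable {A C S S'}
def CMod.val (f : CMod A C S) : L →₀ C := Subtype.val (p := (· ∈ Finsupp.supported C A S.carrier)) f

lemma CMod.ext {f g : CMod A C S} (h : ∀ x ∈ S.carrier, f.val x = g.val x) : f = g := by
  apply Subtype.ext
  ext x
  by_cases hx : x ∈ S.carrier
  · exact h x hx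
  · have h1 := (Finsupp.mem_supported' A _).mp f.2 x hx
    have h2 := (Finsupp.mem_supported' A _).mp g.2 x hx
    exact h1.trans h2.symm

lemma CMod.val_eq_zero (f : CMod A C S) {x : L} (hx : x ∉ S.carrier) : f.val x = 0 :=
  (Finsupp.mem_supported' A _).mp f.2 x hx

@[simp] lemma CMod.val_zero : (0 : CMod A C S).val = 0 := rfl
@[simp] lemma CMod.val_add (f g : CMod A C S) : (f + g).val = f.val + g.val := rfl
@[simp] lemma CMod.val_smul (a : A) (g : CMod A C S) : (a • g).val = a • g.val := rfl

variable (A C S S') in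
noncomputable def T (q : L) : CMod A C S →ₗ[A] CMod A C S' where
  toFun f := tr A C S'.carrier q f.val
  map_add' f g := by simp; rfl
  map_smul' a f := by simp; rfl

open Classical in
lemma T_val (q : L) (f : CMod A C S) (x : L) :
    (T A C S S' q f).val x = if x ∈ S'.carrier then f.val (x - q) else 0 :=
  tr_apply A C S'.carrier q f.val x

variable (A C S) in
noncomputable def act : AddMonoidAlgebra A P →ₐ[A] Module.End A (CMod A C S) :=
  AddMonoidAlgebra.lift A _ P
    { toFun := fun q => T A C S S (q.toAdd : L)
      map_one' := by
        ext f
        apply CMod.ext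
        intro x hx
        simp [T_val, hx]
      map_mul' := fun q r => by
        ext f
        apply CMod.ext
        intro x hx
        simp only [Module.End.mul_apply, T_val, hx, if_true]
        split_ifs with h1
        · congr 1
          simp [sub_sub]
        · apply CMod.val_eq_zero
          intro h2
          apply h1
          have := S.conv _ _ _ h2 r.toAdd.2 q.toAdd.2 (by
            have e : x - ((Multiplicative.toAdd (q * r) : P) : L) + (r.toAdd : L) + (q.toAdd : L) = x := by
              simp only [toAdd_mul, AddSubmonoid.coe_add]; abel
            rw [e]; exact hx)
          have e : x - ((Multiplicative.toAdd (q * r) : P) : L) + (r.toAdd : L) = x - (q.toAdd : L) := by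
              simp only [toAdd_mul, AddSubmonoid.coe_add]; abel
          rw [e] at this; exact this }

noncomputable instance : Module (AddMonoidAlgebra A P) (CMod A C S) :=
  Module.compHom _ (act A C S).toRingHom

lemma smul_def (l : AddMonoidAlgebra A P) (f : CMod A C S) : l • f = act A C S l f := rfl

lemma single_smul (q : P) (a : A) (f : CMod A C S) :
    AddMonoidAlgebra.single q a • f = a • T A C S S q f := by
  rw [smul_def, act, AddMonoidAlgebra.lift_single]; rfl

/-- Promote to a linear map over the monoid algebra. -/
noncomputable def T0 (h : ∀ x ∈ S'.carrier, ∀ q ∈ P, x - q ∈ S.carrier →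
    (x ∈ S.carrier ↔ x - q ∈ S'.carrier)) : CMod A C S →ₗ[AddMonoidAlgebra A P] CMod A C S' where
  toFun := T A C S S' 0
  map_add' := by simp
  map_smul' l f := by
    induction l using AddMonoidAlgebra.induction_linear with
    | zero => simp
    | add a b ha hb => simp only [add_smul, map_add, ha, hb]
    | single q a =>
      simp only [single_smul, map_smul, RingHom.id_apply]
      congr 1
      apply CMod.ext
      intro x hx
      simp only [T_val, hx, if_true, sub_zero]
      by_cases h1 : x - q ∈ S.carrier
      · have := h x hx q q.2 h1
        by_cases hS : x ∈ S.carrier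
        · rw [if_pos hS, if_pos (this.mp hS)]
        · rw [if_neg hS, if_neg (fun h => hS (this.mpr h))]
      · simp [CMod.val_eq_zero f h1]

open Classical in
lemma T0_val (h) (f : CMod A C S) (x : L) :
    (T0 (S' := S') h f).val x = if x ∈ S'.carrier then f.val x else 0 := by
  have := T_val (S' := S') 0 f x
  rw [sub_zero] at this
  exact this

/-- upper-closed subset exact sequence -/
lemma DP.upper {N : ModuleCat.{u} (AddMonoidAlgebra A P)} {n : ℕ} (S Y Z : CSet P)
    (hYS : Y.carrier ⊆ S.carrier) (hZ : Z.carrier = S.carrier \ Y.carrier)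
    (hup : ∀ y ∈ Y.carrier, ∀ q ∈ P, y + q ∈ S.carrier → y + q ∈ Y.carrier)
    (h1 : DP N n (CMod A C Y)) (h2 : DP N n (CMod A C Z)) : DP N n (CMod A C S) := by
  have c1 : ∀ x ∈ S.carrier, ∀ q ∈ P, x - q ∈ Y.carrier →
    (x ∈ Y.carrier ↔ x - q ∈ S.carrier) := by
    intro x hx q hq h
    have := hup _ h q hq
    simp only [sub_add_cancel] at this
    exact ⟨fun _ => hYS h, fun _ => this hx⟩
  have c2 : ∀ x ∈ Z.carrier, ∀ q ∈ P, x - q ∈ S.carrier →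
    (x ∈ S.carrier ↔ x - q ∈ Z.carrier) := by
    intro x hx q hq h
    rw [hZ] at hx ⊢
    refine ⟨fun _ => ⟨h, fun h' => hx.2 ?_⟩, fun _ => hx.1⟩
    have := hup _ h' q hq
    simp only [sub_add_cancel] at this
    exact this hx.1
  have hZS : Z.carrier ⊆ S.carrier := by rw [hZ]; exact Set.sdiff_subset
  refine DP.ses (f := T0 (A := A) (C := C) c1) (g := T0 (A := A) (C := C) c2) ?_ ?_ ?_ h1 h2
  · rw [injective_iff_map_eq_zero]
    intro f hf
    apply CMod.ext
    intro x hx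
    have := congrArg (fun g => CMod.val g x) hf
    simpa [T0_val, hYS hx] using this
  · intro f
    refine ⟨T A C Z S 0 f, CMod.ext ?_⟩
    intro x hx
    simp [T0_val, T_val, hx, hZS hx]
  · intro f
    constructor
    · intro hf
      refine ⟨T A C S Y 0 f, CMod.ext ?_⟩
      intro x hx
      by_cases hxY : x ∈ Y.carrier
      · simp [T0_val, T_val, hx, hxY]
      · have := congrArg (fun g => CMod.val g x) hf
        have hxZ : x ∈ Z.carrier := by rw [hZ]; exact ⟨hx, hxY⟩
        simp only [T0_val, hxZ, if_true] at this
        simp [T0_val, T_val, hx, hxY, this]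
    · rintro ⟨g, rfl⟩
      apply CMod.ext
      intro x hx
      have hx' := hx
      rw [hZ] at hx
      simp [T0_val, hx', hx.1, CMod.val_eq_zero g hx.2]

lemma DP.empty {N : ModuleCat.{u} (AddMonoidAlgebra A P)} {n : ℕ} (S : CSet P)
    (h : S.carrier = ∅) : DP N n (CMod A C S) := by
  have : Subsingleton (CMod A C S) := ⟨fun f g => CMod.ext fun x hx => by simp [h] at hx⟩
  exact DP.of_subsingleton

lemma CSet.ext {S S' : CSet P} (h : S.carrier = S'.carrier) : S = S' := by
  cases S; cases S'; congr

lemma DP.filtration {N : ModuleCat.{u} (AddMonoidAlgebra A P)} {n : ℕ} (V : Finset ℝ) (τ : L → ℝ) :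
    ∀ (S : CSet P) (_ : ∀ p ∈ S.carrier, τ p ∈ V)
    (_ : ∀ p ∈ S.carrier, ∀ q ∈ P, p + q ∈ S.carrier → τ p ≤ τ (p + q))
    (_ : ∀ t ∈ V, ∀ Y : CSet P, Y.carrier = {p ∈ S.carrier | τ p = t} → DP N n (CMod A C Y)),
    DP N n (CMod A C S) := by
  induction V using Finset.induction_on_max with
  | empty =>
    intro S hS _ _
    apply DP.empty
    ext p
    simp only [Set.mem_empty_iff_false, iff_false]
    intro hp
    simpa using hS p hp
  | insert a V ha ih =>
    intro S hS hmono hfib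
    have hle : ∀ p ∈ S.carrier, τ p ≤ a := by
      intro p hp
      rcases Finset.mem_insert.mp (hS p hp) with h | h
      · exact h.le
      · exact (ha _ h).le
    let Y : CSet P := ⟨{p ∈ S.carrier | τ p = a}, by
      rintro p q r ⟨hp, hpa⟩ hq hr ⟨h, ha⟩
      have h1 := S.conv p q r hp hq hr h
      refine ⟨h1, le_antisymm (hle _ h1) ?_⟩
      rw [← hpa]
      exact hmono p hp q hq h1⟩
    let Z : CSet P := ⟨S.carrier \ Y.carrier, by
      rintro p q r ⟨hp, hpa⟩ hq hr ⟨h, ha⟩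
      have h1 := S.conv p q r hp hq hr h
      refine ⟨h1, fun h2 => ha ⟨h, le_antisymm (hle _ h) ?_⟩⟩
      rw [← h2.2]
      exact hmono _ h1 r hr h⟩
    refine DP.upper S Y Z (fun x hx => hx.1) rfl ?_ (hfib a (by simp) Y rfl) ?_
    · rintro y ⟨hy, hya⟩ q hq h
      refine ⟨h, le_antisymm (hle _ h) ?_⟩
      rw [← hya]
      exact hmono _ hy q hq h
    · apply ih Z
      · rintro p ⟨hp, hpa⟩
        rcases Finset.mem_insert.mp (hS p hp) with h | h
        · exact absurd ⟨hp, h⟩ hpa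
        · exact h
      · rintro p ⟨hp, _⟩ q hq ⟨h, _⟩
        exact hmono p hp q hq h
      · intro t ht Y' hY'
        apply hfib t (by simp [ht]) Y'
        rw [hY']
        ext p
        constructor
        · rintro ⟨⟨h1, h2⟩, h3⟩; exact ⟨h1, h3⟩
        · rintro ⟨h1, h3⟩
          exact ⟨⟨h1, fun h => by have := ha t ht; rw [← h3, h.2] at this; exact lt_irrefl _ this⟩, h3⟩

/-- dividing by a monomial -/
lemma DP.monomial {N : ModuleCat.{u} (AddMonoidAlgebra A P)} {n : ℕ} (S Z : CSet P) (b : P)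
    (hb : AddMonoidAlgebra.single b 1 ∈ Module.annihilator (AddMonoidAlgebra A P) N)
    (hS : ∀ s ∈ S.carrier, s + b ∈ S.carrier)
    (hZ : Z.carrier = {s ∈ S.carrier | s - b ∉ S.carrier})
    (h : DP N n (CMod A C Z)) : DP N (n+1) (CMod A C S) := by
  have c2 : ∀ x ∈ Z.carrier, ∀ q ∈ P, x - q ∈ S.carrier →
    (x ∈ S.carrier ↔ x - q ∈ Z.carrier) := by
    intro x hx q hq h
    rw [hZ] at hx ⊢
    refine ⟨fun _ => ⟨h, fun h' => hx.2 ?_⟩, fun _ => hx.1⟩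
    have := S.conv _ q b h' hq b.2 (by
      rw [show x - q - b + q + b = x by abel]; exact hx.1)
    rw [show x - q - b + q = x - b by abel] at this; exact this
  refine DP.reg' (x := AddMonoidAlgebra.single b 1) ?_ hb (g := T0 (A := A) (C := C) c2) ?_ ?_ h
  · apply IsSMulRegular.of_right_eq_zero_of_smul
    intro f hf
    apply CMod.ext
    intro x hx
    have := congrArg (fun g => CMod.val g (x + b)) hf
    simpa [single_smul, T_val, hS x hx] using this
  · intro f
    refine ⟨T A C Z S 0 f, CMod.ext ?_⟩
    intro x hx
    have hx' := hx
    rw [hZ] at hx'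
    simp [T0_val, T_val, hx, hx'.1]
  · intro f
    constructor
    · intro hf
      refine ⟨T A C S S (-b) f, CMod.ext ?_⟩
      intro x hx
      by_cases hxb : x - b ∈ S.carrier
      · simp [single_smul, T_val, hx, hxb]
      · have := congrArg (fun g => CMod.val g x) hf
        have hxZ : x ∈ Z.carrier := by rw [hZ]; exact ⟨hx, hxb⟩
        simp only [T0_val, hxZ, if_true] at this
        simp [single_smul, T_val, hx, hxb, this]
    · rintro ⟨g, rfl⟩
      apply CMod.ext
      intro x hx
      have hx' := hx
      rw [hZ] at hx
      simp [T0_val, hx', hx.1, single_smul, T_val, CMod.val_eq_zero g hx.2]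

end conic
end HCM
end

section
namespace HCM
open RingTheory.Sequence
universe u

section conicthm
variable {L : Type} [AddCommGroup L] {D : Type} [AddCommGroup D] [Module ℚ D]
  [FiniteDimensional ℚ D]

/-- The rational directions of `w`. -/
noncomputable def Wsp (w : D →ₗ[ℚ] ℝ) : Submodule ℚ D :=
  Submodule.comap w (LinearMap.range (Algebra.linearMap ℚ ℝ))

omit [FiniteDimensional ℚ D] in
lemma mem_Wsp {w : D →ₗ[ℚ] ℝ} {x : D} : x ∈ Wsp w ↔ ∃ q : ℚ, (q : ℝ) = w x := by
  simp [Wsp]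

lemma exists_rat_pos (E : Type) [AddCommGroup E] [Module ℚ E] [FiniteDimensional ℚ E]
    (v : E →ₗ[ℚ] ℝ) (J : Finset E) (hJ : ∀ x ∈ J, 0 < v x) :
    ∃ b : E →ₗ[ℚ] ℚ, ∀ x ∈ J, 0 < b x := by
  let e := Module.finBasis ℚ E
  let F : E → (Fin (Module.finrank ℚ E) → ℝ) → ℝ := fun x c => ∑ i, (e.repr x i : ℝ) * c i
  have hF : ∀ x, Continuous (F x) := fun x => by fun_prop
  let U : Set (Fin (Module.finrank ℚ E) → ℝ) := ⋂ x ∈ J, (F x) ⁻¹' Set.Ioi 0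
  have hU : IsOpen U := isOpen_biInter_finset fun x _ => (isOpen_Ioi).preimage (hF x)
  have hv : (fun i => v (e i)) ∈ U := by
    simp only [U, Set.mem_iInter]
    intro x hx
    have : F x (fun i => v (e i)) = v x := by
      conv_rhs => rw [← e.sum_repr x, map_sum]
      simp only [F, map_smul, Rat.smul_def]
    simp only [Set.mem_preimage, this]
    exact hJ x hx
  have hd : DenseRange (Pi.map (fun (_ : Fin (Module.finrank ℚ E)) (q : ℚ) => (q : ℝ))) :=
    DenseRange.piMap fun _ => Rat.denseRange_cast
  obtain ⟨c, hc⟩ := hd.exists_mem_open hU ⟨_, hv⟩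
  refine ⟨e.constr ℚ c, fun x hx => ?_⟩
  simp only [U, Set.mem_iInter] at hc
  have := hc x hx
  simp only [Set.mem_preimage, F, Pi.map, Set.mem_Ioi] at this
  rw [Module.Basis.constr_apply_fintype]
  simp only [smul_eq_mul, Module.Basis.equivFun_apply]
  exact_mod_cast this

lemma exists_generic (D : Type) [AddCommGroup D] [Module ℚ D] [FiniteDimensional ℚ D] :
    ∃ η : D →ₗ[ℚ] ℝ, ∀ x, (∃ q : ℚ, (q : ℝ) = η x) → x = 0 := by
  obtain ⟨φ, hφ⟩ : ∃ φ : (ℚ × D) →ₗ[ℚ] ℝ, Function.Injective φ := by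
    apply Module.Free.exists_linearMap_injective_of_rank_lt
    have h1 : Module.rank ℚ (ℚ × D) < Cardinal.aleph0 := Module.rank_lt_aleph0 ℚ (ℚ × D)
    refine h1.trans_le ?_
    by_contra hlt
    rw [not_le, Module.rank_lt_aleph0_iff] at hlt
    have : Cardinal.mk ℝ ≤ Cardinal.aleph0 := by
      have e := (Module.finBasis ℚ ℝ).equivFun.toEquiv
      have : Countable ℝ := e.countable_iff.mpr inferInstance
      exact Cardinal.mk_le_aleph0
    rw [Cardinal.mk_real] at this
    exact absurd this (not_le.mpr Cardinal.aleph0_lt_continuum)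
  have h0 : φ (1, 0) ≠ 0 := by
    intro h
    have := hφ (h.trans φ.map_zero.symm)
    simp at this
  refine ⟨{ toFun := fun x => φ (0, x) / φ (1, 0), map_add' := ?_, map_smul' := ?_ }, ?_⟩
  · intro x y
    rw [← add_div, ← map_add]; simp
  · intro c x
    have : ((0 : ℚ), c • x) = c • ((0 : ℚ), x) := by simp
    rw [this, map_smul]
    simp [Rat.smul_def, mul_div_assoc]
  · rintro x ⟨q, hq⟩
    simp only [LinearMap.coe_mk, AddHom.coe_mk] at hq
    rw [eq_div_iff h0] at hq
    have : φ (q, 0) = φ (0, x) := by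
      rw [← hq]
      have : (q, (0 : D)) = q • ((1 : ℚ), (0 : D)) := by simp
      rw [this, map_smul, Rat.smul_def]
    have := hφ this
    simp only [Prod.mk.injEq] at this
    exact this.2.symm

variable (ev : L →+ (D →ₗ[ℚ] ℚ)) {J : Type} [Fintype J] (h : J → D) {P : AddSubmonoid L}
  (hP : ∀ x, x ∈ P ↔ ∀ j, 0 ≤ ev x (h j))

/-- The conic set attached to `w`. -/
def Sw (w : D →ₗ[ℚ] ℝ) : CSet P where
  carrier := {p | ∀ j, w (h j) ≤ (ev p (h j) : ℝ) ∧ (h j ∈ Wsp w → (ev p (h j) : ℝ) = w (h j))}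
  conv := by
    intro p q r hp hq hr hs j
    have h1 := (hP q).mp hq j
    have h2 := (hP r).mp hr j
    have h1' : (0 : ℝ) ≤ ev q (h j) := by exact_mod_cast h1
    have h2' : (0 : ℝ) ≤ ev r (h j) := by exact_mod_cast h2
    have h3 := hp j
    have h4 := hs j
    simp only [map_add, LinearMap.add_apply, Rat.cast_add] at h4 ⊢
    refine ⟨by linarith [h3.1], fun hj => ?_⟩
    have := h3.2 hj
    have := h4.2 hj
    linarith

variable {A : Type u} [CommRing A] {C : Type u} [AddCommGroup C] [Module A C]
  (hscale : ∀ φ : D →ₗ[ℚ] ℚ, ∃ n : ℕ, 0 < n ∧ ∃ b : L, ev b = n • φ)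
  (hevZ : ∀ x j, ∃ m : ℤ, ev x (h j) = m)
  (hspan : Submodule.span ℚ (Set.range h) = ⊤)
  (N : ModuleCat.{u} (AddMonoidAlgebra A P))
  (hN : ∀ b : P, b ≠ 0 → AddMonoidAlgebra.single b 1 ∈ Module.annihilator (AddMonoidAlgebra A P) N)

include hscale in
lemma exists_b (w : D →ₗ[ℚ] ℝ) (p : L) (hp : p ∈ (Sw ev h hP w).carrier)
    (hw : Wsp w ≤ Submodule.span ℚ (h '' {j | h j ∈ Wsp w})) :
    ∃ b : L, (∀ x ∈ Wsp w, ev b x = 0) ∧ ∀ j, h j ∉ Wsp w → 0 < ev b (h j) := by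
  classical
  let v : D →ₗ[ℚ] ℝ := (Algebra.linearMap ℚ ℝ).comp (ev p) - w
  have hv : Wsp w ≤ LinearMap.ker v := by
    refine hw.trans ?_
    rw [Submodule.span_le]
    rintro _ ⟨j, hj, rfl⟩
    simp [v, (hp j).2 hj]
  obtain ⟨b, hb⟩ := exists_rat_pos (D ⧸ Wsp w) ((Wsp w).liftQ v hv)
    (((Finset.univ.filter fun j => h j ∉ Wsp w)).image fun j => (Wsp w).mkQ (h j)) (by
      simp only [Finset.mem_image, Finset.mem_filter, Finset.mem_univ, true_and]
      rintro _ ⟨j, hj, rfl⟩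
      simp only [Submodule.mkQ_apply, Submodule.liftQ_apply]
      have h1 := (hp j).1
      have h2 : w (h j) ≠ ev p (h j) := fun h2 => hj (mem_Wsp.mpr ⟨_, h2.symm⟩)
      simp [v]
      exact lt_of_le_of_ne h1 h2)
  obtain ⟨n, hn, b', hb'⟩ := hscale (b.comp (Wsp w).mkQ)
  refine ⟨b', fun x hx => ?_, fun j hj => ?_⟩
  · rw [hb']
    have : (Submodule.Quotient.mk x : D ⧸ Wsp w) = 0 := by simpa using hx
    simp [this]
  · rw [hb']
    have := hb ((Wsp w).mkQ (h j)) (by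
      simp only [Finset.mem_image, Finset.mem_filter, Finset.mem_univ, true_and]
      exact ⟨j, hj, rfl⟩)
    simp only [LinearMap.smul_apply, LinearMap.comp_apply, nsmul_eq_mul]
    positivity

include hscale hevZ hspan hN in
theorem conic (r : ℕ) : ∀ (w : D →ₗ[ℚ] ℝ)
    (_ : Wsp w ≤ Submodule.span ℚ (h '' {j | h j ∈ Wsp w}))
    (_ : Module.finrank ℚ (Wsp w) + r = Module.finrank ℚ D),
    DP N r (CMod A C (Sw ev h hP w)) := by
  classical
  induction r with
  | zero => intro w _ _ i hi; omega
  | succ r ih =>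
    intro w hw hr
    by_cases hne : (Sw ev h hP w).carrier = ∅
    · exact DP.empty _ hne
    obtain ⟨p₀, hp₀⟩ := Set.nonempty_iff_ne_empty.mpr hne
    obtain ⟨b, hb0, hbpos⟩ := exists_b ev h hP hscale w p₀ hp₀ hw
    let J' : Finset J := Finset.univ.filter fun j => h j ∉ Wsp w
    have hJ' : J'.Nonempty := by
      by_contra hcon
      rw [Finset.not_nonempty_iff_eq_empty, Finset.filter_eq_empty_iff] at hcon
      have : Wsp w = ⊤ := by
        rw [eq_top_iff, ← hspan, Submodule.span_le]
        rintro _ ⟨j, rfl⟩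
        simpa using hcon (Finset.mem_univ j)
      rw [this, finrank_top] at hr
      omega
    have hbP : b ∈ P := by
      rw [hP]
      intro j
      by_cases hj : h j ∈ Wsp w
      · exact (hb0 _ hj).ge
      · exact (hbpos j hj).le
    have hbne : (⟨b, hbP⟩ : P) ≠ 0 := by
      obtain ⟨j, hj⟩ := hJ'
      intro h0
      have h1 : b = 0 := congrArg Subtype.val h0
      have := hbpos j (Finset.mem_filter.mp hj).2
      rw [h1] at this
      simp at this
    -- the function τ
    let f : J → L → ℝ := fun j p => ((ev p (h j) : ℝ) - w (h j)) / (ev b (h j) : ℝ)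
    let τ : L → ℝ := fun p => J'.inf' hJ' fun j => f j p
    have hbR : ∀ j ∈ J', (0 : ℝ) < ev b (h j) := by
      intro j hj
      exact_mod_cast hbpos j (Finset.mem_filter.mp hj).2
    have hτle : ∀ p, ∀ j ∈ J', τ p * ev b (h j) ≤ ev p (h j) - w (h j) := by
      intro p j hj
      rw [← le_div_iff₀ (hbR j hj)]
      exact Finset.inf'_le (fun j => f j p) hj
    have hτex : ∀ p, ∃ j ∈ J', τ p * ev b (h j) = ev p (h j) - w (h j) := by
      intro p
      obtain ⟨j, hj, e⟩ := Finset.exists_mem_eq_inf' hJ' (fun j => f j p)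
      refine ⟨j, hj, ?_⟩
      rw [← eq_div_iff (hbR j hj).ne']
      exact e
    have hτge : ∀ p t, (∀ j ∈ J', t * ev b (h j) ≤ ev p (h j) - w (h j)) → t ≤ τ p := by
      intro p t ht
      apply Finset.le_inf'
      intro j hj
      rw [le_div_iff₀ (hbR j hj)]
      exact ht j hj
    have hb0' : ∀ j, j ∉ J' → h j ∈ Wsp w := by
      intro j hj
      by_contra hc
      exact hj (Finset.mem_filter.mpr ⟨Finset.mem_univ _, hc⟩)
    have hJW : ∀ j ∈ J', h j ∉ Wsp w := fun j hj => (Finset.mem_filter.mp hj).2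
    have hS : ∀ s ∈ (Sw ev h hP w).carrier, s + b ∈ (Sw ev h hP w).carrier := by
      intro s hs j
      have h1 := hs j
      have h2 := (hP b).mp hbP j
      have h2' : (0 : ℝ) ≤ ev b (h j) := by exact_mod_cast h2
      simp only [map_add, LinearMap.add_apply, Rat.cast_add]
      refine ⟨by linarith [h1.1], fun hj => ?_⟩
      rw [hb0 _ hj, h1.2 hj]; simp
    -- membership in terms of τ
    have hmem : ∀ s, s ∈ (Sw ev h hP w).carrier ↔
        0 ≤ τ s ∧ ∀ j, j ∉ J' → (ev s (h j) : ℝ) = w (h j) := by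
      intro s
      constructor
      · intro hs
        refine ⟨hτge _ _ fun j hj => ?_, fun j hj => (hs j).2 (hb0' j hj)⟩
        have := (hs j).1
        linarith
      · rintro ⟨h1, h2⟩ j
        by_cases hj : j ∈ J'
        · refine ⟨?_, fun hc => absurd hc (hJW j hj)⟩
          have := hτle s j hj
          have := mul_nonneg h1 (hbR j hj).le
          linarith
        · exact ⟨(h2 j hj).ge, fun _ => h2 j hj⟩
    have hτsub : ∀ s, τ (s - b) = τ s - 1 := by
      intro s
      apply le_antisymm
      · rw [le_sub_iff_add_le]
        apply hτge
        intro j hj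
        have := hτle (s - b) j hj
        simp only [map_sub, LinearMap.sub_apply, Rat.cast_sub] at this
        linarith
      · apply hτge
        intro j hj
        have := hτle s j hj
        simp only [map_sub, LinearMap.sub_apply, Rat.cast_sub]
        linarith
    have hmemb : ∀ s ∈ (Sw ev h hP w).carrier, (s - b ∉ (Sw ev h hP w).carrier ↔ τ s < 1) := by
      intro s hs
      rw [hmem, hτsub]
      have h2 := ((hmem s).mp hs).2
      constructor
      · intro h3
        by_contra h4
        apply h3
        refine ⟨by linarith, fun j hj => ?_⟩
        rw [← h2 j hj]
        simp [hb0 _ (hb0' j hj)]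
      · rintro h3 ⟨h4, -⟩
        linarith
    have hmono : ∀ p, ∀ q ∈ P, τ p ≤ τ (p + q) := by
      intro p q hq
      apply hτge
      intro j hj
      have h1 := hτle p j hj
      have h2 : (0 : ℝ) ≤ ev q (h j) := by exact_mod_cast (hP q).mp hq j
      simp only [map_add, LinearMap.add_apply, Rat.cast_add]
      linarith
    let Z : CSet P := ⟨{s ∈ (Sw ev h hP w).carrier | s - b ∉ (Sw ev h hP w).carrier}, by
      rintro p q r ⟨hp, hpb⟩ hq hr ⟨h1, h2⟩
      have h3 := (Sw ev h hP w).conv p q r hp hq hr h1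
      refine ⟨h3, ?_⟩
      rw [hmemb _ h3]
      rw [hmemb _ h1] at h2
      exact (hmono _ r hr).trans_lt h2⟩
    refine DP.monomial (Sw ev h hP w) Z ⟨b, hbP⟩ (hN _ hbne) hS rfl ?_
    -- the finite set of values
    let V : Finset ℝ := J'.biUnion fun j =>
      (Finset.Icc ⌈w (h j)⌉ ⌊w (h j) + ev b (h j)⌋).image
        fun m : ℤ => ((m : ℝ) - w (h j)) / (ev b (h j) : ℝ)
    refine DP.filtration V τ Z ?_ (fun p _ q hq _ => hmono p q hq) ?_
    · rintro p ⟨hp, hpb⟩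
      rw [hmemb _ hp] at hpb
      have h0 := ((hmem p).mp hp).1
      obtain ⟨j, hj, e⟩ := hτex p
      obtain ⟨m, hm⟩ := hevZ p j
      have hb := hbR j hj
      simp only [V, Finset.mem_biUnion, Finset.mem_image, Finset.mem_Icc]
      rw [hm] at e
      simp only [Rat.cast_intCast] at e
      refine ⟨j, hj, m, ⟨?_, ?_⟩, ?_⟩
      · rw [Int.ceil_le]
        nlinarith
      · rw [Int.le_floor]
        nlinarith
      · rw [div_eq_iff hb.ne']
        exact e.symm
    · intro t _ Y hY
      by_cases hYe : Y.carrier = ∅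
      · exact DP.empty _ hYe
      obtain ⟨p, hp⟩ := Set.nonempty_iff_ne_empty.mpr hYe
      rw [hY] at hp
      obtain ⟨⟨hp, hpb⟩, hpt⟩ := hp
      rw [hmemb _ hp] at hpb
      have h0 := ((hmem p).mp hp).1
      obtain ⟨j₀, hj₀, e⟩ := hτex p
      rw [hpt] at e h0 hpb
      let w' : D →ₗ[ℚ] ℝ := w + (LinearMap.mulLeft ℚ t).comp ((Algebra.linearMap ℚ ℝ).comp (ev b))
      have hw' : ∀ x, w' x = w x + t * ev b x := fun x => by simp [w']
      have hle : Wsp w ≤ Wsp w' := by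
        intro x hx
        obtain ⟨q, hq⟩ := mem_Wsp.mp hx
        exact mem_Wsp.mpr ⟨q, by rw [hw', hb0 x hx, hq]; simp⟩
      have hj₀W : h j₀ ∈ Wsp w' := mem_Wsp.mpr ⟨ev p (h j₀), by rw [hw']; linarith⟩
      have hWsp0 : ∀ j₀ ∈ J', h j₀ ∈ Wsp w' → Wsp w' = Wsp w ⊔ Submodule.span ℚ {h j₀} := by
        intro j₀ hj₀ hj₀W
        apply le_antisymm
        · intro x hx
          obtain ⟨q, hq⟩ := mem_Wsp.mp hx
          obtain ⟨q₀, hq₀⟩ := mem_Wsp.mp hj₀W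
          rw [hw'] at hq hq₀
          have hb := hbR j₀ hj₀
          let c : ℚ := ev b x / ev b (h j₀)
          have hc : (c : ℝ) * ev b (h j₀) = ev b x := by
            simp only [c, Rat.cast_div]
            field_simp
          have : x - c • h j₀ ∈ Wsp w := by
            refine mem_Wsp.mpr ⟨q - c * q₀, ?_⟩
            push_cast
            rw [hq, hq₀, map_sub, map_smul, Rat.smul_def, ← hc]
            ring
          rw [← sub_add_cancel x (c • h j₀)]
          exact Submodule.add_mem_sup this (Submodule.smul_mem _ _ (Submodule.mem_span_singleton_self _))
        · refine sup_le hle ?_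
          rw [Submodule.span_singleton_le_iff_mem]
          exact hj₀W
      have hWsp := hWsp0 j₀ hj₀ hj₀W
      have hspan' : Wsp w' ≤ Submodule.span ℚ (h '' {j | h j ∈ Wsp w'}) := by
        conv_lhs => rw [hWsp]
        refine sup_le (hw.trans (Submodule.span_mono ?_)) ?_
        · exact Set.image_mono fun j hj => hle hj
        · rw [Submodule.span_singleton_le_iff_mem]
          exact Submodule.subset_span ⟨j₀, hj₀W, rfl⟩
      have hrank : Module.finrank ℚ (Wsp w') = Module.finrank ℚ (Wsp w) + 1 := by
        rw [hWsp]
        have h1 := Submodule.finrank_sup_add_finrank_inf_eq (Wsp w) (Submodule.span ℚ {h j₀})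
        have h2 : Wsp w ⊓ Submodule.span ℚ {h j₀} = ⊥ := by
          rw [← disjoint_iff, Submodule.disjoint_span_singleton' (by
            intro hz
            exact hJW j₀ hj₀ (by rw [hz]; exact Submodule.zero_mem _))]
          exact hJW j₀ hj₀
        have h3 : Module.finrank ℚ (Submodule.span ℚ {h j₀}) = 1 := finrank_span_singleton (by
            intro hz
            exact hJW j₀ hj₀ (by rw [hz]; exact Submodule.zero_mem _))
        rw [h2, finrank_bot, h3] at h1
        omega
      have key : Y = Sw ev h hP w' := by
        apply CSet.ext
        rw [hY]
        ext s
        constructor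
        · rintro ⟨⟨hs, hsb⟩, hst⟩
          have : ∀ j ∈ J', t * ev b (h j) ≤ ev s (h j) - w (h j) := fun j hj => hst ▸ hτle s j hj
          obtain ⟨j₁, hj₁, e₁⟩ := hτex s
          rw [hst] at e₁
          have hj₁W : h j₁ ∈ Wsp w' := mem_Wsp.mpr ⟨ev s (h j₁), by rw [hw']; linarith⟩
          have hker : Wsp w' ≤ LinearMap.ker ((Algebra.linearMap ℚ ℝ).comp (ev s) - w') := by
            rw [hWsp0 j₁ hj₁ hj₁W]
            refine sup_le (hw.trans ?_) ?_
            · rw [Submodule.span_le]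
              rintro _ ⟨j, hj, rfl⟩
              simp [hw', (hs j).2 hj, hb0 _ hj]
            · rw [Submodule.span_singleton_le_iff_mem]
              simp only [LinearMap.mem_ker, LinearMap.sub_apply, LinearMap.comp_apply, hw',
                Algebra.linearMap_apply, eq_ratCast]
              linarith
          intro j
          constructor
          · by_cases hj : j ∈ J'
            · have := this j hj
              rw [hw']; linarith
            · rw [hw', hb0 _ (hb0' j hj)]
              have := (hs j).1
              simpa using this
          · intro hj
            have := hker hj
            simp only [LinearMap.mem_ker, LinearMap.sub_apply, LinearMap.comp_apply,
                Algebra.linearMap_apply, eq_ratCast] at this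
            linarith
        · intro hs
          have h1 : ∀ j, j ∉ J' → (ev s (h j) : ℝ) = w (h j) := by
            intro j hj
            have := (hs j).2 (hle (hb0' j hj))
            rw [hw', hb0 _ (hb0' j hj)] at this
            simpa using this
          have h2 : t ≤ τ s := by
            apply hτge
            intro j hj
            have := (hs j).1
            rw [hw'] at this
            linarith
          have h3 : τ s ≤ t := by
            have h4 := hτle s j₀ hj₀
            have h5 := (hs j₀).2 hj₀W
            rw [hw'] at h5
            have := hbR j₀ hj₀
            nlinarith
          have h4 : s ∈ (Sw ev h hP w).carrier := (hmem s).mpr ⟨h0.trans h2, h1⟩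
          refine ⟨⟨h4, (hmemb s h4).mpr ?_⟩, le_antisymm h3 h2⟩
          exact h3.trans_lt hpb
      rw [key]
      exact ih w' hspan' (by omega)

def Pset (P : AddSubmonoid L) : CSet P := ⟨(P : Set L), fun _ _ _ hp hq _ _ => P.add_mem hp hq⟩

include hP hscale hevZ hspan hN in
theorem conic_cone (u : L) (hu : ∀ j, h j ≠ 0 → 0 < ev u (h j)) :
    DP N (Module.finrank ℚ D) (CMod A C (Pset P)) := by
  classical
  obtain ⟨η, hη⟩ := exists_generic D
  obtain ⟨K, hK⟩ : ∃ K : ℕ, ∀ j, |η (h j)| < K := by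
    obtain ⟨K, hK⟩ := exists_nat_gt (∑ j, |η (h j)|)
    exact ⟨K, fun j => (Finset.single_le_sum (f := fun j => |η (h j)|) (fun i _ => abs_nonneg _)
      (Finset.mem_univ j)).trans_lt hK⟩
  obtain ⟨U, hU⟩ : ∃ U : ℕ, ∀ j, |(ev u (h j) : ℝ)| < U := by
    obtain ⟨K, hK⟩ := exists_nat_gt (∑ j, |(ev u (h j) : ℝ)|)
    exact ⟨K, fun j => (Finset.single_le_sum (f := fun j => |(ev u (h j) : ℝ)|)
      (fun i _ => abs_nonneg _) (Finset.mem_univ j)).trans_lt hK⟩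
  let c : ℚ := 1 / ((U : ℚ) + 1)
  let δ : ℚ := 1 / ((K : ℚ) + 1)
  let w : D →ₗ[ℚ] ℝ := c • (-((Algebra.linearMap ℚ ℝ).comp (ev u)) + δ • η)
  have hc : (0 : ℝ) < c := by simp only [c]; push_cast; positivity
  have hδ : (0 : ℝ) < δ := by simp only [δ]; push_cast; positivity
  have hw : ∀ x, w x = c * (-(ev u x) + δ * η x) := fun x => by
    simp [w, Rat.smul_def]; ring
  have hW : Wsp w = ⊥ := by
    rw [eq_bot_iff]
    intro x hx
    obtain ⟨q, hq⟩ := mem_Wsp.mp hx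
    rw [hw] at hq
    apply hη x
    refine ⟨(q / c + ev u x) / δ, ?_⟩
    push_cast
    rw [hq]
    field_simp
    ring
  have hS : Sw ev h hP w = Pset P := by
    apply CSet.ext
    ext p
    change (∀ j, w (h j) ≤ (ev p (h j) : ℝ) ∧ (h j ∈ Wsp w → (ev p (h j) : ℝ) = w (h j))) ↔ p ∈ P
    rw [hP]
    refine forall_congr' fun j => ?_
    rw [hW, Submodule.mem_bot]
    by_cases hj : h j = 0
    · simp [hj]
    · simp only [hj, false_imp_iff, and_true]
      obtain ⟨m, hm⟩ := hevZ p j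
      obtain ⟨k, hk⟩ := hevZ u j
      have h1 := hu j hj
      rw [hk] at h1
      have h1' : (1 : ℤ) ≤ k := by
        have : (0 : ℤ) < k := by exact_mod_cast h1
        omega
      have h1r : (1 : ℝ) ≤ k := by exact_mod_cast h1'
      have h2 := hU j
      have h3 := hK j
      have h4 : |(δ : ℝ) * η (h j)| < 1 := by
        rw [abs_mul, abs_of_pos hδ]
        have : (δ : ℝ) * (K + 1) = 1 := by simp only [δ]; push_cast; field_simp
        nlinarith
      rw [abs_lt] at h4
      have hneg : w (h j) < 0 := by
        rw [hw, hk]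
        apply mul_neg_of_pos_of_neg hc
        push_cast
        linarith
      have hgt : -1 < w (h j) := by
        rw [hw]
        have : (c : ℝ) * (U + 1) = 1 := by simp only [c]; push_cast; field_simp
        rw [abs_lt] at h2
        nlinarith
      rw [hm]
      constructor
      · intro h5
        have h6 : (-1 : ℝ) < m := by
          have : (w (h j)) ≤ (m : ℝ) := by exact_mod_cast h5
          linarith
        have : (-1 : ℤ) < m := by exact_mod_cast h6
        have : (0 : ℤ) ≤ m := by omega
        exact_mod_cast this
      · intro h5
        have : (0 : ℝ) ≤ m := by exact_mod_cast h5
        push_cast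
        linarith
  rw [← hS]
  apply conic ev h hP hscale hevZ hspan N hN
  · rw [hW]; exact bot_le
  · rw [hW]; simp

end conicthm
end HCM
end

section
namespace HCM
universe u

lemma exists_between_rat {ι : Type*} (s : Finset ι) (f g : ι → ℚ) (p q : ι → Prop)
    (h : ∀ i ∈ s, ∀ j ∈ s, p i → q j → f i ≤ g j) :
    ∃ t, (∀ i ∈ s, p i → f i ≤ t) ∧ (∀ j ∈ s, q j → t ≤ g j) := by
  classical
  by_cases hne : (s.filter p).Nonempty
  · refine ⟨(s.filter p).sup' hne f, fun i hi hp => Finset.le_sup' f (by simp [hi, hp]), ?_⟩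
    intro j hj hq
    apply Finset.sup'_le
    intro i hi
    rw [Finset.mem_filter] at hi
    exact h i hi.1 j hj hi.2 hq
  · by_cases hne' : (s.filter q).Nonempty
    · refine ⟨(s.filter q).inf' hne' g, fun i hi hp => ?_, fun j hj hq => Finset.inf'_le g (by simp [hj, hq])⟩
      exact absurd ⟨i, by simp [hi, hp]⟩ hne
    · exact ⟨0, fun i hi hp => absurd ⟨i, by simp [hi, hp]⟩ hne,
        fun i hi hp => absurd ⟨i, by simp [hi, hp]⟩ hne'⟩

lemma facets {d : ℕ} (s : Finset (Fin d → ℤ)) :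
    ∃ H : Finset ((Fin d → ℤ) →+ ℤ), ∀ v, (∃ n : ℕ, 0 < n ∧ n • v ∈ AddSubmonoid.closure (s : Set (Fin d → ℤ)))
      ↔ ∀ h ∈ H, 0 ≤ h v := by
  classical
  induction s using Finset.induction_on with
  | empty =>
    refine ⟨(Finset.univ.image fun i => Pi.evalAddMonoidHom (fun _ : Fin d => ℤ) i) ∪
      (Finset.univ.image fun i => -Pi.evalAddMonoidHom (fun _ : Fin d => ℤ) i), fun v => ?_⟩
    simp only [Finset.coe_empty, AddSubmonoid.closure_empty, AddSubmonoid.mem_bot, smul_eq_zero]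
    constructor
    · rintro ⟨n, hn, h | h⟩
      · omega
      · simp [h]
    · intro h
      refine ⟨1, one_pos, Or.inr ?_⟩
      ext i
      have h1 := h (Pi.evalAddMonoidHom (fun _ : Fin d => ℤ) i) (by simp)
      have h2 := h (-Pi.evalAddMonoidHom (fun _ : Fin d => ℤ) i) (by simp)
      simp at h1 h2 ⊢
      omega
  | insert a s _ ih =>
    obtain ⟨H, hH⟩ := ih
    let Hn : Finset ((Fin d → ℤ) →+ ℤ) := H.filter fun h => 0 ≤ h a
    refine ⟨Hn ∪ ((H ×ˢ H).filter fun x => 0 < x.1 a ∧ x.2 a < 0).image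
      fun x => (-(x.2 a)) • x.1 + (x.1 a) • x.2, fun v => ?_⟩
    have hstep : (∃ n : ℕ, 0 < n ∧ n • v ∈ AddSubmonoid.closure ((insert a s : Finset _) : Set (Fin d → ℤ))) ↔
        ∃ n m : ℕ, 0 < n ∧ ∀ h ∈ H, m * h a ≤ n * h v := by
      constructor
      · rintro ⟨n, hn, h⟩
        rw [Finset.coe_insert, Set.insert_eq, AddSubmonoid.closure_union, AddSubmonoid.mem_sup] at h
        obtain ⟨y, hy, z, hz, e⟩ := h
        obtain ⟨m, rfl⟩ := AddSubmonoid.mem_closure_singleton.mp hy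
        refine ⟨n, m, hn, fun h hh => ?_⟩
        have h1 := (hH z).mp ⟨1, one_pos, by simpa using hz⟩ h hh
        have h2 := congrArg h e
        rw [map_add, map_nsmul, map_nsmul] at h2
        simp only [nsmul_eq_mul] at h2
        linarith
      · rintro ⟨n, m, hn, h⟩
        obtain ⟨k, hk, hk'⟩ := (hH (n • v - m • a)).mpr (fun f hf => by
          have := h f hf
          rw [map_sub, map_nsmul, map_nsmul]
          simp only [nsmul_eq_mul]
          linarith)
        refine ⟨k * n, Nat.mul_pos hk hn, ?_⟩
        rw [Finset.coe_insert, Set.insert_eq, AddSubmonoid.closure_union, AddSubmonoid.mem_sup]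
        refine ⟨(k * m) • a, AddSubmonoid.mem_closure_singleton.mpr ⟨_, rfl⟩, _, hk', ?_⟩
        rw [smul_sub, smul_smul, smul_smul]; abel
    rw [hstep]
    constructor
    · rintro ⟨n, m, hn, h⟩ f hf
      have hn' : (0 : ℤ) < n := by exact_mod_cast hn
      rcases Finset.mem_union.mp hf with hf | hf
      · rw [Finset.mem_filter] at hf
        have h1 := h f hf.1
        have : 0 ≤ (m : ℤ) * f a := mul_nonneg (by positivity) hf.2
        nlinarith
      · simp only [Finset.mem_image, Finset.mem_filter, Finset.mem_product] at hf
        obtain ⟨⟨x, y⟩, ⟨⟨hx, hy⟩, hx0, hy0⟩, rfl⟩ := hf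
        simp only at hx0 hy0 hx hy
        have h1 := h x hx
        have h2 := h y hy
        simp only [AddMonoidHom.add_apply, AddMonoidHom.smul_apply, smul_eq_mul]
        have h3 : 0 ≤ (n : ℤ) * (-(y a) * x v + x a * y v) := by nlinarith
        exact nonneg_of_mul_nonneg_right h3 hn'
    · intro h
      have hpos : ∀ f ∈ H, 0 ≤ f a → 0 ≤ f v := fun f hf h0 =>
        h f (Finset.mem_union_left _ (Finset.mem_filter.mpr ⟨hf, h0⟩))
      have hmix : ∀ x ∈ H, ∀ y ∈ H, 0 < x a → y a < 0 → 0 ≤ -(y a) * x v + x a * y v := by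
        intro x hx y hy hx0 hy0
        have := h ((-(y a)) • x + (x a) • y) (Finset.mem_union_right _ (Finset.mem_image.mpr
          ⟨(x, y), Finset.mem_filter.mpr ⟨Finset.mem_product.mpr ⟨hx, hy⟩, hx0, hy0⟩, rfl⟩))
        simpa using this
      obtain ⟨t, ht1, ht2⟩ := exists_between_rat (insert none (H.image some))
        (fun o => o.elim 0 (fun f => (f v : ℚ) / f a)) (fun o => o.elim 0 (fun f => (f v : ℚ) / f a))
        (fun o => o.elim True (fun f => f a < 0)) (fun o => o.elim False (fun f => 0 < f a)) (by
          intro i hi j hj hp hq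
          rcases j with _ | x
          · exact hq.elim
          simp only [Option.elim_some] at hq
          have hx : x ∈ H := by simpa using hj
          have hq' : (0 : ℚ) < x a := by exact_mod_cast hq
          rcases i with _ | y
          · simp only [Option.elim_none, Option.elim_some]
            have : (0 : ℚ) ≤ x v := by exact_mod_cast hpos x hx hq.le
            positivity
          · simp only [Option.elim_some] at hp ⊢
            have hy : y ∈ H := by simpa using hi
            have hp' : (y a : ℚ) < 0 := by exact_mod_cast hp
            have := hmix x hx y hy hq hp
            have : (0 : ℚ) ≤ -(y a) * x v + x a * y v := by exact_mod_cast this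
            rw [le_div_iff₀ hq', div_mul_eq_mul_div, div_le_iff_of_neg hp']
            linarith)
      have ht0 : 0 ≤ t := ht1 none (by simp) trivial
      refine ⟨t.den, t.num.toNat, t.den_pos, fun f hf => ?_⟩
      rw [Int.toNat_of_nonneg (Rat.num_nonneg.mpr ht0)]
      have key : t * f a ≤ f v := by
        rcases lt_trichotomy (f a) 0 with h0 | h0 | h0
        · have := ht1 (some f) (by simp [hf]) h0
          have h0' : (f a : ℚ) < 0 := by exact_mod_cast h0
          simp only [Option.elim_some] at this
          rwa [div_le_iff_of_neg h0'] at this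
        · have := hpos f hf h0.ge
          rw [h0]
          simp
          exact_mod_cast this
        · have := ht2 (some f) (by simp [hf]) h0
          have h0' : (0 : ℚ) < f a := by exact_mod_cast h0
          simp only [Option.elim_some] at this
          rwa [le_div_iff₀ h0'] at this
      have hd : (0 : ℚ) < t.den := by exact_mod_cast t.den_pos
      have : (t.num : ℚ) * f a ≤ t.den * f v := by
        have e : (t.num : ℚ) = t * t.den := by rw [Rat.mul_den_eq_num]
        rw [e]
        nlinarith
      exact_mod_cast this

/-- Evaluation pairing. -/
noncomputable def evd (d : ℕ) : (Fin d → ℤ) →+ ((Fin d → ℚ) →ₗ[ℚ] ℚ) where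
  toFun x := ∑ i, (x i : ℚ) • LinearMap.proj i
  map_zero' := by simp
  map_add' x y := by simp [add_smul, Finset.sum_add_distrib]

lemma evd_apply {d : ℕ} (x : Fin d → ℤ) (ψ : Fin d → ℚ) : evd d x ψ = ∑ i, (x i : ℚ) * ψ i := by
  simp [evd, LinearMap.sum_apply]

lemma evd_scale {d : ℕ} (φ : (Fin d → ℚ) →ₗ[ℚ] ℚ) :
    ∃ n : ℕ, 0 < n ∧ ∃ b : Fin d → ℤ, evd d b = n • φ := by
  classical
  let c : Fin d → ℚ := fun i => φ (Pi.single i 1)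
  have : ∀ i, ∃ m : ℤ, (m : ℚ) = (∏ j, (c j).den : ℕ) * c i := by
    intro i
    obtain ⟨k, hk⟩ := Finset.dvd_prod_of_mem (fun j => (c j).den) (Finset.mem_univ i)
    refine ⟨k * (c i).num, ?_⟩
    rw [hk]
    push_cast
    have := Rat.mul_den_eq_num (c i)
    rw [← this]; ring
  choose b hb using this
  refine ⟨∏ j, (c j).den, Finset.prod_pos fun j _ => (c j).den_pos, b, ?_⟩
  apply LinearMap.pi_ext'
  intro i
  ext
  simp only [LinearMap.comp_apply, LinearMap.coe_single, evd_apply, LinearMap.smul_apply,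
    nsmul_eq_mul]
  rw [Finset.sum_eq_single i]
  · simp [hb, c]
  · intro j _ hj; simp [hj]
  · simp

theorem cone_DP {d : ℕ} (P : AddSubmonoid (Fin d → ℤ)) (hfg : P.FG)
    (hsat : ∀ x : Fin d → ℤ, ∀ n : ℕ, 0 < n → n • x ∈ P → x ∈ P)
    (hsharp : ∀ x, x ∈ P → -x ∈ P → x = 0)
    (hgen : AddSubgroup.closure (P : Set (Fin d → ℤ)) = ⊤)
    {A : Type u} [CommRing A] (C : Type u) [AddCommGroup C] [Module A C]
    (N : ModuleCat.{u} (AddMonoidAlgebra A P))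
    (hN : ∀ b : P, b ≠ 0 → AddMonoidAlgebra.single b 1 ∈
      Module.annihilator (AddMonoidAlgebra A P) N) :
    DP N d (CMod A C (Pset P)) := by
  classical
  obtain ⟨s, hs⟩ := hfg
  obtain ⟨H, hH⟩ := facets s
  rw [hs] at hH
  let h : H → (Fin d → ℚ) := fun f i => (f.1 (Pi.single i 1) : ℚ)
  have hev : ∀ x (f : H), evd d x (h f) = (f.1 x : ℚ) := by
    intro x f
    rw [evd_apply]
    have e : x = ∑ i, (x i) • Pi.single (M := fun _ : Fin d => ℤ) i 1 := by
      ext j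
      simp [Finset.sum_apply, Pi.single_apply]
    conv_rhs => rw [e]
    rw [map_sum]
    simp only [map_zsmul, h]
    push_cast
    simp
  have hP : ∀ x, x ∈ P ↔ ∀ j, 0 ≤ evd d x (h j) := by
    intro x
    have h1 : x ∈ P ↔ ∃ n : ℕ, 0 < n ∧ n • x ∈ P :=
      ⟨fun hx => ⟨1, one_pos, by simpa using hx⟩, fun ⟨n, hn, hx⟩ => hsat x n hn hx⟩
    rw [h1, hH]
    constructor
    · intro h2 j
      rw [hev]
      exact_mod_cast h2 j.1 j.2
    · intro h2 f hf
      have := h2 ⟨f, hf⟩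
      rw [hev] at this
      exact_mod_cast this
  have hspan : Submodule.span ℚ (Set.range h) = ⊤ := by
    by_contra hne
    obtain ⟨φ, hφ0, hφ⟩ := Submodule.exists_le_ker_of_lt_top _ (lt_top_iff_ne_top.mpr hne)
    obtain ⟨n, hn, b, hb⟩ := evd_scale φ
    have h0 : ∀ j, evd d b (h j) = 0 := by
      intro j
      have : φ (h j) = 0 := hφ (Submodule.subset_span ⟨j, rfl⟩)
      rw [hb]; simp [this]
    have hb0 : b = 0 := hsharp b ((hP b).mpr fun j => (h0 j).ge) ((hP _).mpr fun j => by
      rw [map_neg, LinearMap.neg_apply, h0 j]; simp)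
    rw [hb0, map_zero] at hb
    rcases smul_eq_zero.mp hb.symm with h | h
    · omega
    · exact hφ0 h
  have hex : ∀ j : H, ∃ p ∈ P, h j ≠ 0 → 0 < evd d p (h j) := by
    intro j
    by_contra hcon
    push Not at hcon
    have hj : h j ≠ 0 := (hcon 0 P.zero_mem).1
    have hz : ∀ p ∈ P, evd d p (h j) = 0 := fun p hp =>
      le_antisymm (hcon p hp).2 ((hP p).mp hp j)
    apply hj
    have hall : ∀ x, evd d x (h j) = 0 := by
      intro x
      have hx : x ∈ AddSubgroup.closure (P : Set (Fin d → ℤ)) := by rw [hgen]; trivial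
      induction hx using AddSubgroup.closure_induction with
      | mem x hx => exact hz x hx
      | zero => simp
      | add x y _ _ hx hy => simp [hx, hy]
      | neg x _ hx => simp [hx]
    ext i
    have := hall (Pi.single i 1)
    rw [evd_apply, Finset.sum_eq_single i] at this
    · simpa using this
    · intro k _ hk; simp [hk]
    · simp
  choose p hp hpp using hex
  have := conic_cone (evd d) h hP (C := C) evd_scale (fun x j => ⟨_, hev x j⟩) hspan N hN (∑ j, p j) (by
    intro j hj
    rw [map_sum, LinearMap.sum_apply]
    exact Finset.sum_pos' (fun i _ => (hP _).mp (hp i) j) ⟨j, Finset.mem_univ _, hpp j hj⟩)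
  simpa using this

end HCM
end

section
namespace HCM
open RingTheory.Sequence CategoryTheory
open scoped Pointwise
universe u v

lemma cm_equiv {A : Type u} {B : Type v} [CommRing A] [CommRing B] [IsLocalRing A] [IsLocalRing B]
    (e : A ≃+* B) (h : IsCohenMacaulayLocalRing A) : IsCohenMacaulayLocalRing B := by
  obtain ⟨rs, h1, h2, h3⟩ := h
  refine ⟨rs.map e, ?_, ?_, ?_⟩
  · intro x hx
    obtain ⟨y, hy, rfl⟩ := List.mem_map.mp hx
    have := h1 y hy
    rw [IsLocalRing.mem_maximalIdeal, mem_nonunits_iff] at this ⊢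
    simpa using this
  · refine (AddEquiv.isRegular_congr (M := A) (M₂ := B) (as := rs) (bs := rs.map e)
      (e := e.toAddEquiv) ?_).mp h2
    rw [List.forall₂_map_right_iff]
    refine List.forall₂_same.mpr ?_
    intro r _ x
    simp
  · rw [List.length_map, h3]
    exact ringKrullDim_eq_of_ringEquiv e

lemma cm_loc_iff {B : Type u} {S : Type v} [CommRing B] [CommRing S] [Algebra B S] (M : Submonoid B)
    [IsLocalization M S] (q : Ideal S) [q.IsPrime] (p : Ideal B) [p.IsPrime]
    (hp : p = q.comap (algebraMap B S)) :
    IsCohenMacaulayLocalRing (Localization.AtPrime q) ↔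
      IsCohenMacaulayLocalRing (Localization.AtPrime p) := by
  subst hp
  have := IsLocalization.isLocalization_isLocalization_atPrime_isLocalization M
    (Localization.AtPrime q) q
  let e : Localization.AtPrime (q.comap (algebraMap B S)) ≃ₐ[B] Localization.AtPrime q :=
    IsLocalization.algEquiv (q.comap (algebraMap B S)).primeCompl _ _
  exact ⟨cm_equiv e.symm.toRingEquiv, cm_equiv e.toRingEquiv⟩

lemma cm_of_seq {S : Type u} [CommRing S] [IsNoetherianRing S] (q : Ideal S) [q.IsPrime]
    (rs : List S) (hmem : ∀ r ∈ rs, r ∈ q) (hreg : IsWeaklyRegular S rs)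
    (hh : q.height ≤ rs.length) : IsCohenMacaulayLocalRing (Localization.AtPrime q) := by
  have h1 := hreg.isRegular_of_isLocalization_of_mem (Localization.AtPrime q) q hmem
  refine ⟨_, ?_, h1, ?_⟩
  · intro x hx
    obtain ⟨y, hy, rfl⟩ := List.mem_map.mp hx
    exact (IsLocalization.AtPrime.to_map_mem_maximal_iff (Localization.AtPrime q) q y).mpr
      (hmem y hy)
  · have h2 := ringKrullDim_add_length_eq_ringKrullDim_of_isRegular _ h1
    have h3 := IsLocalization.AtPrime.ringKrullDim_eq_height q (Localization.AtPrime q)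
    apply le_antisymm
    · rw [← h2]
      have : Nontrivial (Localization.AtPrime q ⧸ Ideal.ofList (rs.map (algebraMap S (Localization.AtPrime q)))) := by
        apply Ideal.Quotient.nontrivial_iff.mpr
        intro h
        apply h1.2
        rw [h]; simp
      have := ringKrullDim_nonneg_of_nontrivial (R := Localization.AtPrime q ⧸ Ideal.ofList (rs.map (algebraMap S (Localization.AtPrime q))))
      calc _ = 0 + ((rs.map (algebraMap S (Localization.AtPrime q))).length : WithBot ℕ∞) := by rw [zero_add]; rfl
        _ ≤ _ := by gcongr
    · rw [h3, List.length_map]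
      exact WithBot.coe_le_coe.mpr hh

/-- Flat local criterion. -/
lemma cm_flat {A : Type v} {S : Type u} [CommRing A] [CommRing S] [IsNoetherianRing A]
    [IsNoetherianRing S] [IsLocalRing A] (hA : IsCohenMacaulayLocalRing A) [Algebra A S]
    [Module.Flat A S] (q : Ideal S) [q.IsPrime] [q.LiesOver (IsLocalRing.maximalIdeal A)] (d : ℕ)
    (hd : (q.map (Ideal.Quotient.mk
      ((IsLocalRing.maximalIdeal A).map (algebraMap A S)))).height ≤ d)
    (hDP : ∀ I : Ideal A, DP (ModuleCat.of S (S ⧸ q)) d (S ⧸ I.map (algebraMap A S))) :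
    IsCohenMacaulayLocalRing (Localization.AtPrime q) := by
  obtain ⟨rs, h1, h2, h3⟩ := hA
  have hr := h2.1.of_flat (S := S)
  have hle := Ideal.height_le_height_add_of_liesOver (IsLocalRing.maximalIdeal A) q
  have h4 : (IsLocalRing.maximalIdeal A).height = rs.length := by
    have := IsLocalRing.maximalIdeal_height_eq_ringKrullDim (R := A)
    rw [← h3] at this
    exact WithBot.coe_injective this
  have hm : ∀ r ∈ rs.map (algebraMap A S), r ∈ q := by
    intro r hr
    obtain ⟨y, hy, rfl⟩ := List.mem_map.mp hr
    have := h1 y hy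
    rwa [Ideal.LiesOver.over (P := q) (p := IsLocalRing.maximalIdeal A), Ideal.under,
      Ideal.mem_comap] at this
  have key : DP (ModuleCat.of S (S ⧸ q)) ((rs.map (algebraMap A S)).length + d) S := by
    apply DP.list_reg _ _ hr
    · refine DP.equiv ?_ (hDP (Ideal.ofList rs))
      refine Submodule.quotEquivOfEq _ _ ?_
      rw [Ideal.map_ofList]; simp
    · intro r h
      have := hm r h
      rw [← Ideal.annihilator_quotient (I := q)] at this
      exact this
  obtain ⟨ts, t1, t2, t3⟩ := DP.exists_regular q (Ideal.IsPrime.ne_top ‹_›) key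
  refine cm_of_seq q ts t2 t3.1 ?_
  rw [t1, List.length_map]
  refine hle.trans ?_
  rw [h4]; push_cast; gcongr
end HCM
end

section
namespace HCM
universe u v

lemma dim_le_of_integral {A : Type u} {B : Type v} [CommRing A] [CommRing B] [Algebra A B]
    [Algebra.IsIntegral A B] : ringKrullDim B ≤ ringKrullDim A := by
  refine Order.krullDim_le_of_strictMono (PrimeSpectrum.comap (algebraMap A B)) ?_
  intro I J h
  have : I.asIdeal < J.asIdeal := h
  exact Ideal.IsIntegral.comap_lt_comap this

lemma dim_toric {d : ℕ} (P : AddSubmonoid (Fin d → ℤ)) (hfg : P.FG) (k : Type u) [Field k] :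
    ringKrullDim (AddMonoidAlgebra k P) ≤ d := by
  have : AddMonoid.FG P := (AddMonoid.fg_iff_addSubmonoid_fg P).mpr hfg
  have : Nontrivial (AddMonoidAlgebra k P) := inferInstance
  obtain ⟨s, g, hg, hevZ⟩ := exists_integral_inj_algHom_of_fg k (AddMonoidAlgebra k P)
  algebraize [g.toRingHom]
  have : Algebra.IsIntegral (MvPolynomial (Fin s) k) (AddMonoidAlgebra k P) := ⟨hevZ⟩
  refine dim_le_of_integral (A := MvPolynomial (Fin s) k).trans ?_
  rw [MvPolynomial.ringKrullDim_of_isNoetherianRing, ringKrullDim_eq_zero_of_field]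
  suffices s ≤ d by simpa using this
  let j : AddMonoidAlgebra k P →ₐ[k] AddMonoidAlgebra k (Fin d → ℤ) :=
    AddMonoidAlgebra.mapDomainAlgHom k k P.subtype
  have hj : Function.Injective j := AddMonoidAlgebra.mapDomain_injective Subtype.val_injective
  have h1 := lift_trdeg_le_of_injective (j.comp g) (hj.comp hg)
  rw [MvPolynomial.trdeg_of_isDomain] at h1
  let S : Set (AddMonoidAlgebra k (Fin d → ℤ)) :=
    Set.range fun i : Fin d => AddMonoidAlgebra.single (Pi.single i 1) 1
  have halg : Algebra.IsAlgebraic (Algebra.adjoin k S) (AddMonoidAlgebra k (Fin d → ℤ)) := by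
    let C := Subalgebra.algebraicClosure (Algebra.adjoin k S) (AddMonoidAlgebra k (Fin d → ℤ))
    have hC : ∀ x : Fin d → ℤ, AddMonoidAlgebra.single x (1:k) ∈ C := by
      have hpos : ∀ i : Fin d, AddMonoidAlgebra.single (Pi.single i (1:ℤ)) (1:k) ∈ C := by
        intro i
        exact C.algebraMap_mem ⟨_, Algebra.subset_adjoin (Set.mem_range_self i)⟩
      have hmul : ∀ x y : Fin d → ℤ, AddMonoidAlgebra.single x (1:k) ∈ C →
          AddMonoidAlgebra.single y (1:k) ∈ C → AddMonoidAlgebra.single (x + y) (1:k) ∈ C := by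
        intro x y hx hy
        have := C.mul_mem hx hy
        rwa [AddMonoidAlgebra.single_mul_single, one_mul] at this
      have hneg : ∀ x : Fin d → ℤ, AddMonoidAlgebra.single x (1:k) ∈ C →
          AddMonoidAlgebra.single (-x) (1:k) ∈ C := by
        intro x hx
        let iv : Invertible (AddMonoidAlgebra.single x (1:k)) :=
          ⟨AddMonoidAlgebra.single (-x) 1,
            by rw [AddMonoidAlgebra.single_mul_single, neg_add_cancel, one_mul]; rfl,
            by rw [AddMonoidAlgebra.single_mul_single, add_neg_cancel, one_mul]; rfl⟩
        exact IsAlgebraic.invOf (x := AddMonoidAlgebra.single x (1:k)) hx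
      intro x
      let G : AddSubgroup (Fin d → ℤ) :=
        { carrier := {x | AddMonoidAlgebra.single x (1:k) ∈ C}
          add_mem' := fun {a b} ha hb => hmul a b ha hb
          zero_mem' := C.one_mem
          neg_mem' := fun {a} ha => hneg a ha }
      change x ∈ G
      have : x = ∑ i, x i • Pi.single i (1:ℤ) := by
        ext j
        simp [Finset.sum_apply, Pi.single_apply]
      rw [this]
      exact sum_mem fun i _ => G.zsmul_mem (hpos i) _
    refine ⟨fun f => ?_⟩
    change f ∈ C
    induction f using AddMonoidAlgebra.induction_linear with
    | zero => exact C.zero_mem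
    | add f g hf hg => exact C.add_mem hf hg
    | single x a =>
      have h0 : AddMonoidAlgebra.single (0 : Fin d → ℤ) a ∈ C :=
        C.algebraMap_mem (⟨_, (Algebra.adjoin k S).algebraMap_mem a⟩ : Algebra.adjoin k S)
      have := C.mul_mem h0 (hC x)
      rwa [AddMonoidAlgebra.single_mul_single, zero_add, mul_one] at this
  have h2 := Algebra.IsAlgebraic.trdeg_le_cardinalMk k S
  have h3 : Cardinal.mk S ≤ (d : Cardinal) := by
    have := Cardinal.mk_range_le_lift (f := fun i : Fin d => AddMonoidAlgebra.single (Pi.single i (1:ℤ)) (1:k))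
    simpa using this
  have h4 := h1.trans (Cardinal.lift_le.mpr (h2.trans h3))
  simpa using h4
end HCM
end

section
namespace HCM
open CategoryTheory
universe u v

lemma mem_map_coeff {A : Type u} [CommRing A] {X : Type v} [AddCommMonoid X] (I : Ideal A)
    (f : AddMonoidAlgebra A X) :
    f ∈ I.map (algebraMap A (AddMonoidAlgebra A X)) ↔ ∀ x, f.coeff x ∈ I := by
  constructor
  · intro h
    have hle : I.map (algebraMap A (AddMonoidAlgebra A X)) ≤
        RingHom.ker (AddMonoidAlgebra.mapRingHom X (Ideal.Quotient.mk I)) := by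
      rw [Ideal.map_le_iff_le_comap]
      intro a ha
      rw [Ideal.mem_comap, RingHom.mem_ker, AddMonoidAlgebra.coe_algebraMap]
      simp [Ideal.Quotient.eq_zero_iff_mem.mpr ha]
    intro x
    have := congrArg (fun g => g.coeff x) (RingHom.mem_ker.mp (hle h))
    exact Ideal.Quotient.eq_zero_iff_mem.mp (by simpa using this)
  · intro h
    rw [← AddMonoidAlgebra.sum_coeff_single f]
    refine Ideal.sum_mem _ fun x _ => ?_
    have : AddMonoidAlgebra.single x (f.coeff x) = AddMonoidAlgebra.single x 1 *
      algebraMap A (AddMonoidAlgebra A X) (f.coeff x) := by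
      rw [AddMonoidAlgebra.coe_algebraMap]; simp [AddMonoidAlgebra.single_mul_single]
    rw [this]
    exact Ideal.mul_mem_left _ _ (Ideal.mem_map_of_mem _ (h x))

lemma ker_map' {A A' : Type u} [CommRing A] [CommRing A'] {X : Type v} [AddCommMonoid X]
    (φ : A →+* A') :
    RingHom.ker (AddMonoidAlgebra.mapRingHom X φ) =
      (RingHom.ker φ).map (algebraMap A (AddMonoidAlgebra A X)) := by
  ext f
  rw [mem_map_coeff, RingHom.mem_ker]
  constructor
  · intro h x
    have := congrArg (fun g => g.coeff x) h
    simpa using this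
  · intro h
    ext x
    simpa using h x

noncomputable def quotEquiv {A : Type u} [CommRing A] (X : Type v) [AddCommMonoid X] (I : Ideal A) :
    (AddMonoidAlgebra A X ⧸ I.map (algebraMap A (AddMonoidAlgebra A X))) ≃+*
      AddMonoidAlgebra (A ⧸ I) X :=
  (Ideal.quotEquivOfEq (by rw [ker_map', Ideal.mk_ker])).trans
    (RingHom.quotientKerEquivOfSurjective (f := AddMonoidAlgebra.mapRingHom X (Ideal.Quotient.mk I))
      (AddMonoidAlgebra.map_surjective (Ideal.Quotient.mk I).toAddMonoidHom
        Ideal.Quotient.mk_surjective))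

lemma height_fibre {A : Type u} [CommRing A] [IsLocalRing A] (X : Type v) [AddCommMonoid X]
    (q : Ideal (AddMonoidAlgebra A X)) [q.IsPrime] [q.LiesOver (IsLocalRing.maximalIdeal A)] (d : ℕ)
    (hd : ringKrullDim (AddMonoidAlgebra (IsLocalRing.ResidueField A) X) ≤ d) :
    (q.map (Ideal.Quotient.mk
      ((IsLocalRing.maximalIdeal A).map (algebraMap A (AddMonoidAlgebra A X))))).height ≤ d := by
  have hne : q.map (Ideal.Quotient.mk
      ((IsLocalRing.maximalIdeal A).map (algebraMap A (AddMonoidAlgebra A X)))) ≠ ⊤ := by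
    intro h
    have hle : (IsLocalRing.maximalIdeal A).map (algebraMap A (AddMonoidAlgebra A X)) ≤ q := by
      rw [Ideal.map_le_iff_le_comap]
      exact (Ideal.LiesOver.over (P := q) (p := IsLocalRing.maximalIdeal A)).le
    have h2 := Ideal.comap_map_of_surjective' _ (Ideal.Quotient.mk_surjective
      (I := (IsLocalRing.maximalIdeal A).map (algebraMap A (AddMonoidAlgebra A X)))) q
    rw [h, Ideal.comap_top, Ideal.mk_ker, sup_eq_left.mpr hle] at h2
    exact Ideal.IsPrime.ne_top ‹_› h2.symm
  have h1 := Ideal.height_le_ringKrullDim_of_ne_top hne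
  rw [ringKrullDim_eq_of_ringEquiv (quotEquiv X (IsLocalRing.maximalIdeal A))] at h1
  exact WithBot.coe_le_coe.mp (h1.trans hd)

open scoped AlgebraMonoidAlgebra in
lemma red {B : Type u} [CommRing B] (X : Type v) [AddCommMonoid X]
    (q : Ideal (AddMonoidAlgebra B X)) [q.IsPrime] (p : Ideal B) [p.IsPrime]
    (hp : p = q.comap (algebraMap B (AddMonoidAlgebra B X))) :
    ∃ (q' : Ideal (AddMonoidAlgebra (Localization.AtPrime p) X)) (_ : q'.IsPrime),
      q'.LiesOver (IsLocalRing.maximalIdeal (Localization.AtPrime p)) ∧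
      q'.comap (AddMonoidAlgebra.mapRingHom X (algebraMap B (Localization.AtPrime p))) = q ∧
      (IsCohenMacaulayLocalRing (Localization.AtPrime q') →
        IsCohenMacaulayLocalRing (Localization.AtPrime q)) := by
  have hpush : Algebra.IsPushout B (AddMonoidAlgebra B X) (Localization.AtPrime p)
    (AddMonoidAlgebra (Localization.AtPrime p) X) := inferInstance
  have hloc : IsLocalization (Algebra.algebraMapSubmonoid (AddMonoidAlgebra B X) p.primeCompl)
    (AddMonoidAlgebra (Localization.AtPrime p) X) :=
      (Algebra.isLocalization_iff_isPushout p.primeCompl (Localization.AtPrime p)).mpr hpush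
  have hdisj : Disjoint (Algebra.algebraMapSubmonoid (AddMonoidAlgebra B X) p.primeCompl :
      Set (AddMonoidAlgebra B X)) q := by
    rw [Set.disjoint_left]
    rintro _ ⟨b, hb, rfl⟩ h
    apply hb
    rw [hp]
    exact h
  have hq' := IsLocalization.isPrime_of_isPrime_disjoint _
    (AddMonoidAlgebra (Localization.AtPrime p) X) q ‹_› hdisj
  have hc := IsLocalization.under_map_of_isPrime_disjoint _
    (AddMonoidAlgebra (Localization.AtPrime p) X) ‹q.IsPrime› hdisj
  refine ⟨_, hq', ⟨?_⟩, hc, (cm_loc_iff (Algebra.algebraMapSubmonoid (AddMonoidAlgebra B X) p.primeCompl) _ q hc.symm).mp⟩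
  set q' := Ideal.map (algebraMap (AddMonoidAlgebra B X) (AddMonoidAlgebra (Localization.AtPrime p) X)) q
  rw [← IsLocalization.map_under p.primeCompl (Localization.AtPrime p) (q'.under (Localization.AtPrime p)),
    Ideal.under_under]
  rw [← Ideal.under_under (B := AddMonoidAlgebra B X), hc]
  rw [← Localization.AtPrime.map_eq_maximalIdeal]
  congr 1
end HCM
end

section
namespace HCM
open CategoryTheory
universe u v

section
variable {d : ℕ} (P : AddSubmonoid (Fin d → ℤ)) {A : Type u} [CommRing A] (I : Ideal A)

noncomputable def e0 : CMod A (A ⧸ I) (Pset P) :=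
  ⟨Finsupp.single 0 1, by
    rw [Finsupp.mem_supported']
    intro x hx
    rw [Finsupp.single_apply, if_neg]
    rintro rfl
    exact hx P.zero_mem⟩

lemma e0_val : (e0 P I).val = Finsupp.single 0 1 := rfl

lemma smul_e0_val (l : AddMonoidAlgebra A P) (x : P) :
    (l • e0 P I).val x = Ideal.Quotient.mk I (l.coeff x) := by
  classical
  induction l using AddMonoidAlgebra.induction_linear with
  | zero => simp
  | add f g hf hg => rw [add_smul, CMod.val_add]; simp [hf, hg]
  | single y a =>
    rw [single_smul, CMod.val_smul, Finsupp.smul_apply, T_val, if_pos (show (x : Fin d → ℤ) ∈ (Pset P).carrier from x.2), e0_val,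
      AddMonoidAlgebra.coeff_single, Finsupp.single_apply, Finsupp.single_apply]
    have : (0 = (x : Fin d → ℤ) - y) ↔ y = x := by
      rw [eq_comm, sub_eq_zero, eq_comm, Subtype.coe_inj]
    simp only [this]
    split_ifs
    · rw [Algebra.smul_def, mul_one]; rfl
    · simp

lemma CMod_DP_equiv : Nonempty ((AddMonoidAlgebra A P ⧸ I.map (algebraMap A (AddMonoidAlgebra A P)))
    ≃ₗ[AddMonoidAlgebra A P] CMod A (A ⧸ I) (Pset P)) := by
  let φ := LinearMap.toSpanSingleton (AddMonoidAlgebra A P) (CMod A (A ⧸ I) (Pset P)) (e0 P I)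
  have hsurj : Function.Surjective φ := by
    intro f
    obtain ⟨l, hl⟩ := AddMonoidAlgebra.map_surjective (M := P) (Ideal.Quotient.mk I).toAddMonoidHom
        Ideal.Quotient.mk_surjective
        (AddMonoidAlgebra.ofCoeff (f.val.comapDomain Subtype.val Subtype.val_injective.injOn))
    refine ⟨l, CMod.ext fun x hx => ?_⟩
    have h1 := smul_e0_val P I l ⟨x, hx⟩
    have h2 := congrArg (fun g => g.coeff ⟨x, hx⟩) hl
    simp at h2
    exact h1.trans h2
  have hker : I.map (algebraMap A (AddMonoidAlgebra A P)) = LinearMap.ker φ := by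
    ext l
    rw [mem_map_coeff, LinearMap.mem_ker]
    constructor
    · intro h
      refine CMod.ext fun x hx => ?_
      have := smul_e0_val P I l ⟨x, hx⟩
      rw [Ideal.Quotient.eq_zero_iff_mem.mpr (h _)] at this
      exact this
    · intro h x
      have := smul_e0_val P I l x
      rw [show l • e0 P I = 0 from h] at this
      exact Ideal.Quotient.eq_zero_iff_mem.mp this.symm
  exact ⟨(Submodule.quotEquivOfEq _ _ hker).trans (φ.quotKerEquivOfSurjective hsurj)⟩
end

/-- Cone points of toric rings. -/
theorem cm_cone {d : ℕ} (P : AddSubmonoid (Fin d → ℤ)) (hfg : P.FG)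
    (hsat : ∀ (x : Fin d → ℤ) (n : ℕ), 0 < n → n • x ∈ P → x ∈ P)
    (hsharp : ∀ x, x ∈ P → -x ∈ P → x = 0) (hgen : AddSubgroup.closure (P : Set (Fin d → ℤ)) = ⊤)
    {B : Type u} [CommRing B] [IsNoetherianRing B] (hB : IsCohenMacaulayRing B)
    (q : Ideal (AddMonoidAlgebra B P)) [q.IsPrime]
    (hq : ∀ b : P, b ≠ 0 → AddMonoidAlgebra.single b 1 ∈ q) :
    IsCohenMacaulayLocalRing (Localization.AtPrime q) := by
  obtain ⟨q', hq', hover, hc, himp⟩ := red P q _ rfl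
  apply himp
  have : AddMonoid.FG P := (AddMonoid.fg_iff_addSubmonoid_fg P).mpr hfg
  set A := Localization.AtPrime (q.comap (algebraMap B (AddMonoidAlgebra B P)))
  have : IsNoetherianRing (AddMonoidAlgebra A P) := 
    Algebra.FiniteType.isNoetherianRing A _
  refine cm_flat (A := A) (hB _ _) q' d (height_fibre P q' d (dim_toric P hfg _)) ?_
  intro I
  obtain ⟨e⟩ := CMod_DP_equiv P I
  refine DP.equiv e.symm (cone_DP P hfg hsat hsharp hgen _ _ ?_)
  intro b hb
  change _ ∈ Module.annihilator _ (AddMonoidAlgebra A P ⧸ q')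
  rw [Ideal.annihilator_quotient]
  have := hq b hb
  rw [← hc, Ideal.mem_comap] at this
  simpa using this
end HCM
end

section
namespace HCM
open CategoryTheory
universe u v

lemma cm_localization {B : Type u} {S : Type v} [CommRing B] [CommRing S] [Algebra B S]
    (M : Submonoid B) [IsLocalization M S] (h : IsCohenMacaulayRing B) : IsCohenMacaulayRing S := by
  intro q hq
  exact (cm_loc_iff M q (q.comap (algebraMap B S)) rfl).mpr (h _ _)

lemma cm_ringEquiv {B : Type u} {S : Type v} [CommRing B] [CommRing S] (e : B ≃+* S)
    (h : IsCohenMacaulayRing B) : IsCohenMacaulayRing S := by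
  algebraize [e.toRingHom]
  have : IsLocalization (⊥ : Submonoid B) S :=
    IsLocalization.of_le_isUnit_of_bijective (by rintro _ ⟨x, hx, rfl⟩; rw [SetLike.mem_coe, Submonoid.mem_bot] at hx; simp [hx]) e.bijective
  exact cm_localization (⊥ : Submonoid B) h

lemma cm_finite {B : Type u} [CommRing B] [IsNoetherianRing B] (h : IsCohenMacaulayRing B)
    (X : Type) [AddCommMonoid X] [Finite X] : IsCohenMacaulayRing (AddMonoidAlgebra B X) := by
  intro q hq
  obtain ⟨q', hq', hover, hc, himp⟩ := red X q _ rfl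
  apply himp
  set A := Localization.AtPrime (q.comap (algebraMap B (AddMonoidAlgebra B X)))
  have : IsNoetherianRing (AddMonoidAlgebra A X) :=
    Algebra.FiniteType.isNoetherianRing A _
  refine cm_flat (A := A) (h _ _) q' 0 (height_fibre X q' 0 ?_) ?_
  · have : Algebra.IsIntegral (IsLocalRing.ResidueField A) (AddMonoidAlgebra (IsLocalRing.ResidueField A) X) := by
      have : Module.Finite (IsLocalRing.ResidueField A) (AddMonoidAlgebra (IsLocalRing.ResidueField A) X) := inferInstance
      infer_instance
    refine (dim_le_of_integral (A := IsLocalRing.ResidueField A)).trans ?_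
    rw [ringKrullDim_eq_zero_of_field]; simp
  · intro I i hi
    omega

lemma reg_nat {A : Type u} [CommRing A] (f : AddMonoidAlgebra A ℕ) (n : ℕ) (hf : IsUnit (f.coeff n))
    (I : Ideal A) : IsSMulRegular (AddMonoidAlgebra A ℕ ⧸ I.map (algebraMap A (AddMonoidAlgebra A ℕ))) f := by
  let e : (AddMonoidAlgebra A ℕ ⧸ I.map (algebraMap A (AddMonoidAlgebra A ℕ))) ≃+* Polynomial (A ⧸ I) :=
    (quotEquiv ℕ I).trans (Polynomial.toFinsuppIso (A ⧸ I)).symm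
  have he : (e (Ideal.Quotient.mk _ f)).coeff n = Ideal.Quotient.mk I (f.coeff n) := by
    have : quotEquiv ℕ I (Ideal.Quotient.mk _ f) = AddMonoidAlgebra.mapRingHom ℕ (Ideal.Quotient.mk I) f := rfl
    simp only [e, RingEquiv.trans_apply, this]
    change AddMonoidAlgebra.coeff (AddMonoidAlgebra.mapRingHom ℕ (Ideal.Quotient.mk I) f) n = _
    simp
  have hnz : e (Ideal.Quotient.mk _ f) ∈ nonZeroDivisors (Polynomial (A ⧸ I)) := by
    by_contra hcon
    rw [Polynomial.notMem_nonZeroDivisors_iff] at hcon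
    obtain ⟨a, ha, h0⟩ := hcon
    have := congrArg (fun g => g.coeff n) h0
    simp only [Polynomial.coeff_smul, he, Polynomial.coeff_zero, smul_eq_mul] at this
    exact ha (((hf.map (Ideal.Quotient.mk I)).mul_left_eq_zero).mp this)
  refine isSMulRegular_iff_right_eq_zero_of_smul.mpr ?_
  intro x hx
  have hx' : Ideal.Quotient.mk _ f * x = 0 := by
    obtain ⟨y, rfl⟩ := Ideal.Quotient.mk_surjective x
    exact hx
  have h2 : e x * e (Ideal.Quotient.mk _ f) = 0 := by
    rw [← map_mul, mul_comm, hx', map_zero]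
  have := (mem_nonZeroDivisors_iff.mp hnz).2 _ h2
  simpa using this

lemma cm_nat {B : Type u} [CommRing B] [IsNoetherianRing B] (h : IsCohenMacaulayRing B) :
    IsCohenMacaulayRing (AddMonoidAlgebra B ℕ) := by
  intro q hq
  obtain ⟨q', hq', hover, hc, himp⟩ := red ℕ q _ rfl
  apply himp
  set A := Localization.AtPrime (q.comap (algebraMap B (AddMonoidAlgebra B ℕ)))
  have : IsNoetherianRing (AddMonoidAlgebra A ℕ) :=
    Algebra.FiniteType.isNoetherianRing A _
  by_cases hcase : q' ≤ (IsLocalRing.maximalIdeal A).map (algebraMap A (AddMonoidAlgebra A ℕ))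
  · refine cm_flat (A := A) (h _ _) q' 0 ?_ ?_
    · have hb : Ideal.map (Ideal.Quotient.mk ((IsLocalRing.maximalIdeal A).map (algebraMap A (AddMonoidAlgebra A ℕ)))) q' = ⊥ := by
        rw [Ideal.map_eq_bot_iff_le_ker, Ideal.mk_ker]
        exact hcase
      have : Nontrivial (AddMonoidAlgebra A ℕ ⧸ (IsLocalRing.maximalIdeal A).map (algebraMap A (AddMonoidAlgebra A ℕ))) :=
        (quotEquiv ℕ (IsLocalRing.maximalIdeal A)).symm.injective.nontrivial
      rw [hb]; simp
    · intro I i hi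
      omega
  · obtain ⟨f, hf, hfm⟩ := Set.not_subset.mp hcase
    rw [SetLike.mem_coe, mem_map_coeff] at hfm
    push Not at hfm
    obtain ⟨n, hn⟩ := hfm
    refine cm_flat (A := A) (h _ _) q' 1 (height_fibre ℕ q' 1 ?_) ?_
    · rw [ringKrullDim_eq_of_ringEquiv (Polynomial.toFinsuppIso (IsLocalRing.ResidueField A)).symm,
        Polynomial.ringKrullDim_of_isNoetherianRing, ringKrullDim_eq_zero_of_field]
      simp
    · intro I
      refine DP.reg (x := f) (reg_nat f n (by simpa using hn) I) ?_ (fun i hi => by omega)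
      rw [← Ideal.annihilator_quotient (I := q')] at hf
      exact hf

/-- Monoids such that adjoining them preserves the Cohen–Macaulay property. -/
def Good (X : Type v) [AddCommMonoid X] : Prop :=
  AddMonoid.FG X ∧ ∀ (B : Type u) [CommRing B] [IsNoetherianRing B], IsCohenMacaulayRing B →
    IsCohenMacaulayRing (AddMonoidAlgebra B X)

lemma good_finite (X : Type) [AddCommMonoid X] [Finite X] : Good.{u} X :=
  ⟨AddMonoid.fg_of_finite, fun _ _ _ h => cm_finite h X⟩

lemma good_int : Good.{u} ℤ := by
  refine ⟨inferInstance, fun B _ _ h => ?_⟩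
  have h1 : IsCohenMacaulayRing (Polynomial B) :=
    cm_ringEquiv (Polynomial.toFinsuppIso B).symm (cm_nat h)
  have : IsLocalization.Away (Polynomial.X : Polynomial B) (LaurentPolynomial B) := inferInstance
  exact cm_localization (S := LaurentPolynomial B) (Submonoid.powers (Polynomial.X : Polynomial B)) h1

lemma good_equiv {X : Type} {Y : Type v} [AddCommMonoid X] [AddCommMonoid Y] (e : X ≃+ Y)
    (h : Good.{u} X) : Good.{u} Y := by
  have := h.1
  refine ⟨AddMonoid.fg_of_surjective e.toAddMonoidHom e.surjective, fun B _ _ hB => ?_⟩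
  exact cm_ringEquiv (AddMonoidAlgebra.mapDomainRingEquiv B e) (h.2 B hB)

lemma good_prod {X Y : Type} [AddCommMonoid X] [AddCommMonoid Y]
    (h : Good.{u} X) (h' : Good.{u} Y) : Good.{u} (X × Y) := by
  have := h.1
  have := h'.1
  refine ⟨inferInstance, fun B _ _ hB => ?_⟩
  have : IsNoetherianRing (AddMonoidAlgebra B Y) := Algebra.FiniteType.isNoetherianRing B _
  exact cm_ringEquiv AddMonoidAlgebra.curryRingEquiv.symm (h.2 _ (h'.2 B hB))

lemma good_fin (n : ℕ) : Good.{u} (Fin n → ℤ) := by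
  induction n with
  | zero => exact good_finite _
  | succ n ih =>
    exact good_equiv (Fin.consLinearEquiv ℤ (fun _ : Fin (n+1) => ℤ)).toAddEquiv
      (good_prod good_int ih)

theorem good_group (U : Type v) [AddCommGroup U] [AddGroup.FG U] : Good.{u} U := by
  obtain ⟨n, ι, _, p, hp, e, ⟨f⟩⟩ := AddCommGroup.equiv_free_prod_directSum_zmod U
  refine good_equiv f.symm (good_prod ?_ ?_)
  · exact good_equiv (Finsupp.linearEquivFunOnFinite ℤ ℤ (Fin n)).symm.toAddEquiv (good_fin n)
  · have : ∀ i, NeZero (p i ^ e i) := fun i => ⟨pow_ne_zero _ (hp i).ne_zero⟩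
    classical
    have : Finite (DirectSum ι fun i => ZMod (p i ^ e i)) :=
      Finite.of_equiv _ (DirectSum.addEquivProd (fun i => ZMod (p i ^ e i))).symm.toEquiv
    exact good_finite _
end HCM
end

section
namespace HCM
open RingTheory.Sequence CategoryTheory
open scoped Pointwise
universe u v

lemma cm_descent_local {A : Type v} {T : Type u} [CommRing A] [CommRing T] [IsNoetherianRing A]
    [IsNoetherianRing T] [IsLocalRing A] [IsLocalRing T] [Algebra A T]
    [Module.FaithfullyFlat A T] (hT : IsCohenMacaulayLocalRing T)
    (hdim : ringKrullDim A ≤ ringKrullDim T)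
    (hmin : ∀ P : Ideal T, P.IsPrime → (IsLocalRing.maximalIdeal A).map (algebraMap A T) ≤ P →
      P = IsLocalRing.maximalIdeal T) : IsCohenMacaulayLocalRing A := by
  obtain ⟨ts, t1, t2, t3⟩ := hT
  have hDP : DP (ModuleCat.of T (T ⧸ IsLocalRing.maximalIdeal T)) ts.length T :=
    DP.of_regular _ (Ideal.IsPrime.ne_top inferInstance) ts t1 t2
  have step : ∀ n ≤ ts.length, ∃ rs : List A, rs.length = n ∧
      (∀ r ∈ rs, r ∈ IsLocalRing.maximalIdeal A) ∧ IsWeaklyRegular A rs := by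
    intro n
    induction n with
    | zero => intro _; exact ⟨[], rfl, by simp, IsWeaklyRegular.nil _ _⟩
    | succ n ih =>
      intro hn
      obtain ⟨rs, r1, r2, r3⟩ := ih (by omega)
      by_cases hs : Subsingleton ((A ⧸ IsLocalRing.maximalIdeal A) →ₗ[A]
          (A ⧸ (Ideal.ofList rs • ⊤ : Submodule A A)))
      · obtain ⟨x, hx, hreg⟩ := IsSMulRegular.subsingleton_linearMap_iff.mp hs
        rw [Ideal.annihilator_quotient] at hx
        refine ⟨rs ++ [x], by simp [r1], ?_, ?_⟩
        · intro r hr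
          rcases List.mem_append.mp hr with h | h
          · exact r2 r h
          · rw [List.mem_singleton.mp h]; exact hx
        · rw [isWeaklyRegular_append_iff]
          exact ⟨r3, (isWeaklyRegular_singleton_iff _ _).mpr hreg⟩
      · exfalso
        rw [not_subsingleton_iff_nontrivial] at hs
        obtain ⟨φ, hφ⟩ := exists_ne (0 : (A ⧸ IsLocalRing.maximalIdeal A) →ₗ[A]
          (A ⧸ (Ideal.ofList rs • ⊤ : Submodule A A)))
        obtain ⟨a, ha⟩ := Submodule.Quotient.mk_surjective _ (φ (Submodule.Quotient.mk 1))
        have hone : ∀ b : A, φ (Submodule.Quotient.mk b) = Submodule.Quotient.mk (b * a) := by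
          intro b
          have : (Submodule.Quotient.mk b : A ⧸ IsLocalRing.maximalIdeal A)
            = b • Submodule.Quotient.mk 1 := by
            rw [← Submodule.Quotient.mk_smul]; simp
          rw [this, map_smul, ← ha, ← Submodule.Quotient.mk_smul]; rfl
        have ha0 : a ∉ Ideal.ofList rs := by
          intro h
          apply hφ
          ext
          change φ (Submodule.Quotient.mk 1) = 0
          rw [hone, Submodule.Quotient.mk_eq_zero]
          simpa using h
        have hma : ∀ b ∈ IsLocalRing.maximalIdeal A, b * a ∈ Ideal.ofList rs := by
          intro b hb
          have h1 := hone b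
          rw [(Submodule.Quotient.mk_eq_zero _).mpr hb, map_zero] at h1
          have := (Submodule.Quotient.mk_eq_zero _).mp h1.symm
          simpa using this
        have hregT := r3.of_flat (S := T)
        set rT := rs.map (algebraMap A T) with hrT
        have hrTI : Ideal.ofList rT = (Ideal.ofList rs).map (algebraMap A T) := by
          rw [Ideal.map_ofList]
        have hDP1 : DP (ModuleCat.of T (T ⧸ IsLocalRing.maximalIdeal T)) 1
            (T ⧸ (Ideal.ofList rT • ⊤ : Submodule T T)) :=
          DP.list_quot rT hregT (DP.mono (by simp [hrT, r1]; omega) hDP)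
        have haT : (Submodule.Quotient.mk (algebraMap A T a) :
            T ⧸ (Ideal.ofList rT • ⊤ : Submodule T T)) ≠ 0 := by
          rw [Ne, Submodule.Quotient.mk_eq_zero]
          intro h
          apply ha0
          rw [← Ideal.comap_map_eq_self_of_faithfullyFlat (B := T) (Ideal.ofList rs),
            Ideal.mem_comap, ← hrTI]
          simpa using h
        obtain ⟨P, hP, hle⟩ := exists_le_isAssociatedPrime_of_isNoetherianRing (R := T) _ haT
        have hPm : P = IsLocalRing.maximalIdeal T := by
          apply hmin P hP.1
          refine le_trans ?_ hle
          rw [Ideal.map_le_iff_le_comap]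
          intro b hb
          rw [Ideal.mem_comap, Submodule.mem_colon_singleton, Submodule.mem_bot,
            ← Submodule.Quotient.mk_smul, Submodule.Quotient.mk_eq_zero]
          change algebraMap A T b * algebraMap A T a ∈ _
          rw [← map_mul]
          have := Ideal.mem_map_of_mem (algebraMap A T) (hma b hb)
          rw [← hrTI] at this
          simpa using this
        obtain ⟨hPp, y, hy⟩ := (isAssociatedPrime_iff).mp hP
        have hy0 : y ≠ 0 := by
          rintro rfl
          apply hPp.ne_top
          rw [hy, eq_top_iff]
          intro z _
          rw [Submodule.mem_colon_singleton]; simp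
        let ψ : (T ⧸ IsLocalRing.maximalIdeal T) →ₗ[T] (T ⧸ (Ideal.ofList rT • ⊤ : Submodule T T)) :=
          Submodule.liftQ _ (LinearMap.toSpanSingleton T _ y) (by
            intro z hz
            rw [← hPm, hy, Submodule.mem_colon_singleton, Submodule.mem_bot] at hz
            simpa using hz)
        have h0 := DP.hom_eq_zero one_pos hDP1 ψ
        have h1 : ψ (Submodule.Quotient.mk 1) = y := by
          change (LinearMap.toSpanSingleton T _ y) 1 = y
          simp
        rw [h0] at h1
        exact hy0 (by simpa using h1.symm)
  obtain ⟨rs, r1, r2, r3⟩ := step _ le_rfl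
  have hr := (IsLocalRing.isRegular_iff_isWeaklyRegular_of_subset_maximalIdeal (M := A) r2).mpr r3
  refine ⟨rs, r2, hr, ?_⟩
  apply le_antisymm
  · rw [← ringKrullDim_add_length_eq_ringKrullDim_of_isRegular _ hr]
    have : Nontrivial (A ⧸ Ideal.ofList rs) := by
      apply Ideal.Quotient.nontrivial_iff.mpr
      intro h
      apply hr.2
      rw [h]; simp
    have := ringKrullDim_nonneg_of_nontrivial (R := A ⧸ Ideal.ofList rs)
    calc _ = 0 + (rs.length : WithBot ℕ∞) := by rw [zero_add]; rfl
      _ ≤ _ := by gcongr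
  · rw [r1, t3]; exact hdim

lemma cm_descent {R : Type v} {S : Type u} [CommRing R] [CommRing S] [IsNoetherianRing R]
    [IsNoetherianRing S] [Algebra R S] [Module.FaithfullyFlat R S]
    (hS : IsCohenMacaulayRing S) : IsCohenMacaulayRing R := by
  intro p hp
  obtain ⟨Q, hQ, hQp⟩ := Ideal.exists_isPrime_liesOver_of_faithfullyFlat (B := S) p
  have hle : p.map (algebraMap R S) ≤ Q := by
    rw [Ideal.map_le_iff_le_comap]; exact hQp.over.le
  obtain ⟨q, hq, hqQ⟩ := Ideal.exists_minimalPrimes_le hle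
  have hqp : q.IsPrime := hq.1.1
  have hlo : q.LiesOver p := ⟨by
    apply le_antisymm
    · exact Ideal.map_le_iff_le_comap.mp hq.1.2
    · rw [hQp.over]; exact Ideal.comap_mono hqQ⟩
  let := Localization.AtPrime.algebraOfLiesOver p q
  have hloc : IsLocalHom (algebraMap (Localization.AtPrime p) (Localization.AtPrime q)) := by
    rw [Localization.AtPrime.IsLiesOverAlgebra.algebraMap_eq]
    infer_instance
  have : Module.FaithfullyFlat (Localization.AtPrime p) (Localization.AtPrime q) :=
    Module.FaithfullyFlat.of_flat_of_isLocalHom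
  refine cm_descent_local (T := Localization.AtPrime q) (hS q hqp) ?_ ?_
  · rw [IsLocalization.AtPrime.ringKrullDim_eq_height p, IsLocalization.AtPrime.ringKrullDim_eq_height q]
    apply WithBot.coe_le_coe.mpr
    rw [Ideal.height_eq_height_add_of_liesOver_of_hasGoingDown p q]
    exact le_self_add
  · intro P hP hPm
    have hPq : P.comap (algebraMap S (Localization.AtPrime q)) ≤ q := by
      intro x hx
      exact (IsLocalization.AtPrime.to_map_mem_maximal_iff (Localization.AtPrime q) q x).mp
        (IsLocalRing.le_maximalIdeal hP.ne_top hx)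
    have hpP : p.map (algebraMap R S) ≤ P.comap (algebraMap S (Localization.AtPrime q)) := by
      rw [Ideal.map_le_iff_le_comap]
      intro x hx
      rw [Ideal.mem_comap, Ideal.mem_comap, ← IsScalarTower.algebraMap_apply,
        IsScalarTower.algebraMap_apply R (Localization.AtPrime p)]
      apply hPm
      apply Ideal.mem_map_of_mem
      exact (IsLocalization.AtPrime.to_map_mem_maximal_iff (Localization.AtPrime p) p x).mpr hx
    have := hq.2 ⟨Ideal.IsPrime.comap _, hpP⟩ hPq
    apply le_antisymm (IsLocalRing.le_maximalIdeal hP.ne_top)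
    rw [← Localization.AtPrime.map_eq_maximalIdeal, Ideal.map_le_iff_le_comap]
    exact this

lemma cm_base {R : Type v} {Q : Type u} [CommRing R] [IsNoetherianRing R] [CommMonoid Q]
    (hQ : Monoid.FG Q) (h : IsCohenMacaulayRing (MonoidAlgebra R Q)) : IsCohenMacaulayRing R := by
  rcases subsingleton_or_nontrivial R with hR | hR
  · intro p hp
    exact absurd (Subsingleton.elim p ⊤) hp.ne_top
  have : IsNoetherianRing (MonoidAlgebra R Q) := Algebra.FiniteType.isNoetherianRing R _
  exact cm_descent (S := MonoidAlgebra R Q) h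
end HCM
end

section
namespace HCM
universe u v

lemma face_split (X : Type v) [AddCancelCommMonoid X] [AddMonoid.FG X]
    (hsat : ∀ a b : X, ∀ n : ℕ, 0 < n → (∃ c, n • a = n • b + c) → ∃ d, a = b + d)
    (F : AddSubmonoid X) (hF : ∀ x y, x + y ∈ F → x ∈ F) :
    ∃ (U : Type v) (_ : AddCommGroup U) (_ : AddGroup.FG U) (d : ℕ)
      (P : AddSubmonoid (Fin d → ℤ)), P.FG ∧ (∀ x, ∀ n : ℕ, 0 < n → n • x ∈ P → x ∈ P) ∧
      (∀ x, x ∈ P → -x ∈ P → x = 0) ∧ AddSubgroup.closure (P : Set (Fin d → ℤ)) = ⊤ ∧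
      ∃ j : X →+ P × U, Function.Injective j ∧ (∀ f ∈ F, (j f).1 = 0) ∧
        ∀ y, ∃ f ∈ F, ∃ x, y + j f = j x := by
  let G := Algebra.GrothendieckAddGroup X
  let ι : X →+ G := Algebra.GrothendieckAddGroup.of
  have hι : Function.Injective ι := by
    intro a b h
    obtain ⟨c, hc⟩ := (AddLocalization.addMonoidOf (⊤ : AddSubmonoid X)).eq_iff_exists.mp h
    exact add_left_cancel hc
  have hG : ∀ g : G, ∃ a b, g = ι a - ι b := by
    intro g
    obtain ⟨⟨a, b⟩, h⟩ := (AddLocalization.addMonoidOf (⊤ : AddSubmonoid X)).surj g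
    exact ⟨a, b, eq_sub_of_add_eq h⟩
  have hGfg : AddGroup.FG G := AddGroup.fg_iff_addMonoid_fg.mpr inferInstance
  let U : AddSubgroup G :=
    { carrier := {g | ∃ f1 ∈ F, ∃ f2 ∈ F, g = ι f1 - ι f2}
      zero_mem' := ⟨0, F.zero_mem, 0, F.zero_mem, by simp⟩
      add_mem' := by
        rintro _ _ ⟨a, ha, b, hb, rfl⟩ ⟨c, hc, d, hd, rfl⟩
        exact ⟨a + c, F.add_mem ha hc, b + d, F.add_mem hb hd, by simp; abel⟩
      neg_mem' := by
        rintro _ ⟨a, ha, b, hb, rfl⟩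
        exact ⟨b, hb, a, ha, by simp⟩ }
  have hU : ∀ g, g ∈ U ↔ ∃ f1 ∈ F, ∃ f2 ∈ F, g = ι f1 - ι f2 := fun g => Iff.rfl
  have hUF : ∀ x, ι x ∈ U → x ∈ F := by
    intro x hx
    obtain ⟨a, ha, b, hb, h⟩ := (hU _).mp hx
    apply hF x b
    rw [eq_sub_iff_add_eq, ← map_add] at h
    rw [hι h]; exact ha
  have hFU : ∀ x ∈ F, ι x ∈ U := fun x hx => ⟨x, hx, 0, F.zero_mem, by simp⟩
  -- saturation
  have key : ∀ (g : G) (n : ℕ), 0 < n → ∀ x, n • g - ι x ∈ U → ∃ f ∈ F, ∃ y, g + ι f = ι y := by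
    intro g n hn x hx
    obtain ⟨f1, h1, f2, h2, h⟩ := (hU _).mp hx
    obtain ⟨a, b, rfl⟩ := hG g
    obtain ⟨m, rfl⟩ : ∃ m, n = m + 1 := ⟨n - 1, by omega⟩
    obtain ⟨d, hd⟩ := hsat (a + f2) b (m + 1) hn ⟨x + f1 + m • f2, by
      apply hι
      have h' : (m + 1) • ι a = (m + 1) • ι b + ι x + ι f1 - ι f2 := by
        rw [smul_sub] at h
        rw [← sub_eq_zero] at h ⊢
        rw [← h]; abel
      simp only [map_add, map_nsmul, smul_add]
      rw [h', add_smul m 1 (ι f2), one_smul]; abel⟩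
    refine ⟨f2, h2, d, ?_⟩
    have := congrArg ι hd
    rw [map_add, map_add] at this
    rw [sub_add_eq_add_sub, this]; abel
  have htf : ∀ (g : G) (n : ℕ), 0 < n → n • g ∈ U → g ∈ U := by
    intro g n hn hg
    obtain ⟨f, hf, y, h⟩ := key g n hn 0 (by simpa using hg)
    have hy : ι (n • y) ∈ U := by
      rw [map_nsmul, ← h, smul_add]
      exact U.add_mem hg (U.nsmul_mem (hFU f hf) n)
    have hyF := hUF _ hy
    have : y ∈ F := by
      obtain ⟨m, rfl⟩ : ∃ m, n = m + 1 := ⟨n - 1, by omega⟩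
      rw [add_smul, one_smul, add_comm] at hyF
      exact hF _ _ hyF
    rw [eq_sub_of_add_eq h]
    exact U.sub_mem (hFU y this) (hFU f hf)
  have hfin : Module.Finite ℤ G := Module.Finite.iff_addGroup_fg.mpr hGfg
  have hfin' : Module.Finite ℤ (G ⧸ U) :=
    Module.Finite.of_surjective (QuotientAddGroup.mk' U).toIntLinearMap
      (QuotientAddGroup.mk'_surjective U)
  have htor : Module.IsTorsionFree ℤ (G ⧸ U) := by
    rw [Module.isTorsionFree_int_iff_isAddTorsionFree]
    refine ⟨fun n hn a b hab => ?_⟩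
    obtain ⟨a, rfl⟩ := QuotientAddGroup.mk'_surjective U a
    obtain ⟨b, rfl⟩ := QuotientAddGroup.mk'_surjective U b
    have hab' : (QuotientAddGroup.mk' U) (n • (a - b)) = 0 := by
      have h1 : n • (QuotientAddGroup.mk' U) a = n • (QuotientAddGroup.mk' U) b := hab
      rw [map_nsmul, map_sub, smul_sub, h1, sub_self]
    have h2 := htf (a - b) n (Nat.pos_of_ne_zero hn) ((QuotientAddGroup.eq_zero_iff _).mp hab')
    rw [← sub_eq_zero, ← map_sub]
    exact (QuotientAddGroup.eq_zero_iff _).mpr h2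
  have hfree : Module.Free ℤ (G ⧸ U) := Module.free_of_finite_type_torsion_free'
  let bas := Module.finBasis ℤ (G ⧸ U)
  let d := Module.finrank ℤ (G ⧸ U)
  let φ : G →ₗ[ℤ] (Fin d → ℤ) := bas.equivFun.toLinearMap ∘ₗ (QuotientAddGroup.mk' U).toIntLinearMap
  have hφs : Function.Surjective φ :=
    bas.equivFun.surjective.comp (QuotientAddGroup.mk'_surjective U)
  have hφU : ∀ g, φ g = 0 ↔ g ∈ U := by
    intro g
    simp only [φ, LinearMap.comp_apply]
    rw [LinearEquiv.coe_coe, LinearEquiv.map_eq_zero_iff]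
    exact QuotientAddGroup.eq_zero_iff g
  obtain ⟨s, hs⟩ := Module.projective_lifting_property φ LinearMap.id hφs
  have hs' : ∀ y, φ (s y) = y := fun y => LinearMap.congr_fun hs y
  let π : G →+ U := ((LinearMap.id - s ∘ₗ φ : G →ₗ[ℤ] G).toAddMonoidHom).codRestrict U (by
    intro g
    rw [← hφU]
    simp [hs'])
  have hπ : ∀ g, (π g : G) = g - s (φ g) := fun g => rfl
  have hπU : ∀ g : U, π g = g := by
    intro g
    apply Subtype.ext
    rw [hπ, (hφU _).mpr g.2]; simp
  have hUfg : AddGroup.FG U := AddGroup.fg_of_surjective (f := π) (fun g => ⟨g, hπU g⟩)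
  let ψ : X →+ (Fin d → ℤ) := φ.toAddMonoidHom.comp ι
  have hψ : ∀ x, ψ x = φ (ι x) := fun x => rfl
  refine ⟨U, inferInstance, hUfg, d, AddMonoidHom.mrange ψ, ?_, ?_, ?_, ?_,
    (ψ.mrangeRestrict).prod (π.comp ι), ?_, ?_, ?_⟩
  · rw [AddMonoidHom.mrange_eq_map]
    exact AddSubmonoid.FG.map AddMonoid.FG.fg_top ψ
  · rintro y n hn ⟨x, hx⟩
    obtain ⟨g, rfl⟩ := hφs y
    obtain ⟨f, hf, z, hz⟩ := key g n hn x (by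
      rw [← hφU, map_sub, ← hψ, hx]; simp)
    refine ⟨z, ?_⟩
    rw [hψ, ← hz, map_add, (hφU _).mpr (hFU f hf), add_zero]
  · rintro _ ⟨x, rfl⟩ ⟨y, hy⟩
    have : x + y ∈ F := by
      apply hUF
      rw [← hφU, map_add, map_add, ← hψ, ← hψ, hy]; simp
    exact (hφU _).mpr (hFU _ (hF _ _ this))
  · rw [eq_top_iff]
    intro y _
    obtain ⟨g, rfl⟩ := hφs y
    obtain ⟨a, b, rfl⟩ := hG g
    rw [map_sub]
    exact AddSubgroup.sub_mem _ (AddSubgroup.subset_closure ⟨a, rfl⟩)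
      (AddSubgroup.subset_closure ⟨b, rfl⟩)
  · intro a b h
    have h1 : φ (ι a) = φ (ι b) := congrArg (fun t => (t.1 : Fin d → ℤ)) h
    have h2 : ι a - s (φ (ι a)) = ι b - s (φ (ι b)) := congrArg (fun t => (t.2 : G)) h
    rw [h1] at h2
    exact hι (sub_left_inj.mp h2)
  · intro f hf
    exact Subtype.ext ((hφU _).mpr (hFU f hf))
  · rintro ⟨⟨_, x, rfl⟩, w⟩
    obtain ⟨k, hk, f, hf, h⟩ := (hU _).mp (w - π (ι x)).2
    have hfz : φ (ι f) = 0 := (hφU _).mpr (hFU f hf)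
    have hkz : φ (ι k) = 0 := (hφU _).mpr (hFU k hk)
    refine ⟨f, hf, x + k, ?_⟩
    ext1
    · apply Subtype.ext
      change ψ x + φ (ι f) = φ (ι (x + k))
      rw [map_add, map_add, hfz, hkz, hψ]
    · apply Subtype.ext
      change (w : G) + (ι f - s (φ (ι f))) = ι (x + k) - s (φ (ι (x + k)))
      have h' : (w : G) - (ι x - s (φ (ι x))) = ι k - ι f := h
      rw [map_add, map_add, hfz, hkz, map_zero, sub_zero, add_zero]
      rw [← sub_eq_zero] at h' ⊢
      rw [← h']; abel
end HCM
end

namespace HCM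
universe u v w

lemma loc_monomials {R : Type u} [CommRing R] {X : Type v} {Y : Type w} [AddCommMonoid X]
    [AddCommMonoid Y] (F : AddSubmonoid X) (j : X →+ Y) (hj : Function.Injective j)
    (hu : ∀ f ∈ F, ∃ y, j f + y = 0) (hs : ∀ y, ∃ f ∈ F, ∃ x, y + j f = j x)
    [Algebra (AddMonoidAlgebra R X) (AddMonoidAlgebra R Y)]
    (halg : ∀ a, algebraMap (AddMonoidAlgebra R X) (AddMonoidAlgebra R Y) a =
      AddMonoidAlgebra.mapDomainRingHom R j a)
    (M : Submonoid (AddMonoidAlgebra R X))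
    (hM : ∀ a, a ∈ M ↔ ∃ f ∈ F, AddMonoidAlgebra.single f 1 = a) :
    IsLocalization M (AddMonoidAlgebra R Y) := by
  have hinj : Function.Injective (algebraMap (AddMonoidAlgebra R X) (AddMonoidAlgebra R Y)) := by
    have : ⇑(algebraMap (AddMonoidAlgebra R X) (AddMonoidAlgebra R Y)) =
      AddMonoidAlgebra.mapDomainRingHom R j := funext halg
    rw [this]
    exact AddMonoidAlgebra.mapDomain_injective hj
  have hsing : ∀ x r, algebraMap (AddMonoidAlgebra R X) (AddMonoidAlgebra R Y)
      (AddMonoidAlgebra.single x r) = AddMonoidAlgebra.single (j x) r := by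
    intro x r
    rw [halg]; simp
  refine ⟨?_, ?_, ?_⟩
  · rintro ⟨m, hm⟩
    obtain ⟨f, hf, rfl⟩ := (hM m).mp hm
    obtain ⟨y, hy⟩ := hu f hf
    rw [hsing]
    refine IsUnit.of_mul_eq_one (AddMonoidAlgebra.single y 1) ?_
    rw [AddMonoidAlgebra.single_mul_single, hy, mul_one]; rfl
  · intro z
    induction z using AddMonoidAlgebra.induction_linear with
    | zero => exact ⟨(0, 1), by simp⟩
    | add a b ha hb =>
      obtain ⟨⟨x, m⟩, h1⟩ := ha
      obtain ⟨⟨y, n⟩, h2⟩ := hb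
      refine ⟨(x * n + y * m, m * n), ?_⟩
      simp only [Submonoid.coe_mul, map_mul, map_add] at h1 h2 ⊢
      rw [← h1, ← h2]; ring
    | single y r =>
      obtain ⟨f, hf, x, h⟩ := hs y
      refine ⟨(AddMonoidAlgebra.single x r, ⟨AddMonoidAlgebra.single f 1, (hM _).mpr ⟨f, hf, rfl⟩⟩), ?_⟩
      simp only [hsing]
      rw [AddMonoidAlgebra.single_mul_single, h, mul_one]
  · intro a b h
    exact ⟨1, by rw [hinj h]⟩

theorem cm_monoid {R : Type u} [CommRing R] [IsNoetherianRing R] (hR : IsCohenMacaulayRing R)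
    (X : Type v) [AddCancelCommMonoid X] [AddMonoid.FG X]
    (hsat : ∀ a b : X, ∀ n : ℕ, 0 < n → (∃ c, n • a = n • b + c) → ∃ d, a = b + d) :
    IsCohenMacaulayRing (AddMonoidAlgebra R X) := by
  intro q hq
  let F : AddSubmonoid X :=
    { carrier := {x | AddMonoidAlgebra.single x (1 : R) ∉ q}
      zero_mem' := fun h => hq.ne_top ((Ideal.eq_top_iff_one _).mpr h)
      add_mem' := by
        intro a b ha hb h
        rw [← mul_one (1 : R), ← AddMonoidAlgebra.single_mul_single] at h
        exact (hq.mem_or_mem h).elim ha hb }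
  have hFm : ∀ x, x ∈ F ↔ AddMonoidAlgebra.single x (1 : R) ∉ q := fun x => Iff.rfl
  have hF : ∀ x y, x + y ∈ F → x ∈ F := by
    intro x y h hx
    apply h
    rw [← mul_one (1 : R), ← AddMonoidAlgebra.single_mul_single]
    exact Ideal.mul_mem_right _ _ hx
  obtain ⟨U, _, hUfg, d, P, p1, p2, p3, p4, j, j1, j2, j3⟩ := face_split X hsat F hF
  let M : Submonoid (AddMonoidAlgebra R X) :=
    { carrier := {a | ∃ f ∈ F, AddMonoidAlgebra.single f 1 = a}
      one_mem' := ⟨0, F.zero_mem, rfl⟩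
      mul_mem' := by
        rintro _ _ ⟨a, ha, rfl⟩ ⟨b, hb, rfl⟩
        exact ⟨a + b, F.add_mem ha hb, by rw [AddMonoidAlgebra.single_mul_single, mul_one]⟩ }
  let alg1 : Algebra (AddMonoidAlgebra R X) (AddMonoidAlgebra R (P × U)) :=
    (AddMonoidAlgebra.mapDomainRingHom R j).toAlgebra
  have hloc1 : IsLocalization M (AddMonoidAlgebra R (P × U)) := by
    refine loc_monomials F j j1 ?_ j3 (fun _ => rfl) M (fun _ => Iff.rfl)
    intro f hf
    refine ⟨(0, -(j f).2), ?_⟩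
    ext1
    · simp [j2 f hf]
    · simp
  let e : AddMonoidAlgebra R (P × U) ≃+* AddMonoidAlgebra (AddMonoidAlgebra R U) P :=
    AddMonoidAlgebra.curryRingEquiv
  let alg2 : Algebra (AddMonoidAlgebra R X) (AddMonoidAlgebra (AddMonoidAlgebra R U) P) :=
    (e.toRingHom.comp (AddMonoidAlgebra.mapDomainRingHom R j)).toAlgebra
  have hloc2 : IsLocalization M (AddMonoidAlgebra (AddMonoidAlgebra R U) P) :=
    IsLocalization.isLocalization_of_algEquiv M (AlgEquiv.ofRingEquiv (f := e) (fun _ => rfl))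
  have hdis : Disjoint (M : Set (AddMonoidAlgebra R X)) (q : Set (AddMonoidAlgebra R X)) := by
    rw [Set.disjoint_left]
    rintro _ ⟨f, hf, rfl⟩ h
    exact hf h
  let q' : Ideal (AddMonoidAlgebra (AddMonoidAlgebra R U) P) := q.map (algebraMap (AddMonoidAlgebra R X) _)
  have hq' : q'.IsPrime := IsLocalization.isPrime_of_isPrime_disjoint M _ q hq hdis
  have hcom : q = q'.comap (algebraMap (AddMonoidAlgebra R X) _) :=
    (IsLocalization.under_map_of_isPrime_disjoint M _ hq hdis).symm
  refine (cm_loc_iff M q' q hcom).mp ?_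
  have hUm : AddMonoid.FG U := AddGroup.fg_iff_addMonoid_fg.mp hUfg
  have : IsNoetherianRing (AddMonoidAlgebra R U) := Algebra.FiniteType.isNoetherianRing R _
  refine cm_cone P p1 p2 p3 p4 ((good_group U).2 R hR) q' ?_
  intro b hb
  obtain ⟨f, hf, x, hx⟩ := j3 (b, 0)
  have hx1 : (j x).1 = b := by
    rw [← hx]; simp [j2 f hf]
  have hxF : x ∉ F := by
    intro h
    exact hb (by rw [← hx1, j2 x h])
  have hxq : AddMonoidAlgebra.single x (1 : R) ∈ q := by
    by_contra h
    exact hxF h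
  have h1 := Ideal.mem_map_of_mem (algebraMap (AddMonoidAlgebra R X)
    (AddMonoidAlgebra (AddMonoidAlgebra R U) P)) hxq
  have h2 : algebraMap (AddMonoidAlgebra R X) (AddMonoidAlgebra (AddMonoidAlgebra R U) P)
      (AddMonoidAlgebra.single x (1 : R)) =
      AddMonoidAlgebra.single b (AddMonoidAlgebra.single (j x).2 1) := by
    change e (AddMonoidAlgebra.mapDomainRingHom R j (AddMonoidAlgebra.single x (1 : R))) = _
    rw [← hx1]
    simp only [AddMonoidAlgebra.mapDomainRingHom_apply, AddMonoidAlgebra.mapDomain_single]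
    exact AddMonoidAlgebra.curryRingEquiv_single (j x).1 (j x).2 1
  rw [h2] at h1
  have h3 := Ideal.mul_mem_right (AddMonoidAlgebra.single (0 : P)
    (AddMonoidAlgebra.single (-(j x).2) (1 : R))) q' h1
  rw [AddMonoidAlgebra.single_mul_single, AddMonoidAlgebra.single_mul_single, add_zero, mul_one,
    add_neg_cancel] at h3
  exact h3
end HCM

theorem stmt12 {R : Type*} (P Q : Type*) [CommRing R] [IsNoetherianRing R]
    [CancelCommMonoid P] [CancelCommMonoid Q]
    (hPfg : Monoid.FG P) (hQfg : Monoid.FG Q)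
    (hPsat : IsSaturatedMonoid P) (hQsat : IsSaturatedMonoid Q)
    (N : ℕ) (hN : 0 < N) (f : P →* Q) (g : Q →* P) (hgf : ∀ x : P, g (f x) = x ^ N)
    (hCM : IsCohenMacaulayRing (MonoidAlgebra R Q)) :
    IsCohenMacaulayRing (MonoidAlgebra R P) := by
  have hR : IsCohenMacaulayRing R := HCM.cm_base hQfg hCM
  have hfg : AddMonoid.FG (Additive P) := Monoid.fg_iff_add_fg.mp hPfg
  have h := HCM.cm_monoid hR (Additive P) (fun a b n hn hc => hPsat a b n hn hc)
  exact HCM.cm_ringEquiv (MonoidAlgebra.toAdditiveAlgEquiv R R P).toRingEquiv.symm h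
end

section
/- Let F be a field and P a fine monoid. Then for every maximal ideal m of the monoid algebra F[P], the Krull dimension of the localization F[P]_m equals the rank of the finitely generated abelian group P^gp. -/
theorem mv_height (K : Type*) [Field K] (n : ℕ) :
    ∀ m : Ideal (MvPolynomial (Fin n) K), m.IsMaximal → m.height = n := by
  induction n with
  | zero =>
    intro m hm
    have : IsField (MvPolynomial (Fin 0) K) :=
      (MvPolynomial.isEmptyRingEquiv K (Fin 0)).toMulEquiv.isField (Field.toIsField K)
    let _ := this.toField
    have h := Ideal.eq_bot_of_prime m
    subst h
    simp
  | succ n ih =>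
    intro m hm
    let e := (MvPolynomial.finSuccEquiv K n).toRingEquiv
    rw [← RingEquiv.height_map e m]
    have hM : (m.map e).IsMaximal := Ideal.map_isMaximal_of_equiv e
    set M := m.map e
    have h1 : (M.under (MvPolynomial (Fin n) K)).IsMaximal :=
      Polynomial.isMaximal_comap_C_of_isJacobsonRing M
    have h2 : M.LiesOver (M.under (MvPolynomial (Fin n) K)) := ⟨rfl⟩
    rw [Polynomial.height_eq_height_add_one (M.under (MvPolynomial (Fin n) K)) M, ih _ h1]
    simp

theorem height_of_trbasis {K B ι : Type*} [Field K] [CommRing B] [IsDomain B] [Algebra K B]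
    [Algebra.FiniteType K B] [Finite ι] (x : ι → B) (hx : IsTranscendenceBasis K x)
    (m : Ideal B) (hm : m.IsMaximal) : m.height = Nat.card ι := by
  obtain ⟨s, g, hg, hint⟩ := exists_integral_inj_algHom_of_fg K B
  let _ : Algebra (MvPolynomial (Fin s) K) B := g.toRingHom.toAlgebra
  have : IsScalarTower K (MvPolynomial (Fin s) K) B := IsScalarTower.of_algebraMap_eq'
    (g.comp_algebraMap).symm
  have : Algebra.IsIntegral (MvPolynomial (Fin s) K) B := ⟨hint⟩
  have : FaithfulSMul (MvPolynomial (Fin s) K) B := (faithfulSMul_iff_algebraMap_injective _ _).2 hg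
  have : IsNoetherianRing B := Algebra.FiniteType.isNoetherianRing K B
  -- cardinality
  have hb : IsTranscendenceBasis K (algebraMap (MvPolynomial (Fin s) K) B ∘ MvPolynomial.X) :=
    (IsTranscendenceBasis.mvPolynomial (Fin s) K).algebraMap_comp (A := B)
  have hcard : Nat.card ι = s := by
    have := congrArg Cardinal.toNat (hx.lift_cardinalMk_eq hb)
    simpa [Nat.card] using this
  set p := m.under (MvPolynomial (Fin s) K) with hp
  have : p.IsMaximal := Ideal.isMaximal_comap_of_isIntegral_of_isMaximal m
  have h := Ideal.height_eq_height_add_of_liesOver_of_hasGoingDown p m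
  have hz : (m.map (Ideal.Quotient.mk (p.map (algebraMap (MvPolynomial (Fin s) K) B)))).height
      = 0 := by
    set I := p.map (algebraMap (MvPolynomial (Fin s) K) B)
    have hI : I ≤ m := Ideal.map_comap_le
    have hmm : (m.map (Ideal.Quotient.mk I)).IsMaximal := by
      refine .map_of_surjective_of_ker_le Ideal.Quotient.mk_surjective ?_
      rwa [Ideal.mk_ker]
    have := hmm.isPrime
    rw [Ideal.height_eq_zero_iff]
    have : Ring.KrullDimLE 0 (B ⧸ I) := by
      refine Ring.KrullDimLE.mk₀ fun J hJ => ?_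
      have hJ' : (J.comap (Ideal.Quotient.mk I)).IsPrime := inferInstance
      have hle : p ≤ (J.comap (Ideal.Quotient.mk I)).under (MvPolynomial (Fin s) K) := by
        refine Ideal.map_le_iff_le_comap.1 ?_
        intro y hy
        rw [Ideal.mem_comap, Ideal.Quotient.eq_zero_iff_mem.2 hy]
        exact J.zero_mem
      have heq := Ideal.IsMaximal.eq_of_le ‹p.IsMaximal› (Ideal.IsPrime.ne_top inferInstance) hle
      have hmax : (J.comap (Ideal.Quotient.mk I)).IsMaximal :=
        Ideal.isMaximal_of_isIntegral_of_isMaximal_comap _ (heq ▸ ‹p.IsMaximal›)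
      have := Ideal.map_eq_top_or_isMaximal_of_surjective (Ideal.Quotient.mk I) Ideal.Quotient.mk_surjective hmax
      rw [Ideal.map_comap_of_surjective _ Ideal.Quotient.mk_surjective] at this
      exact this.resolve_left hJ.ne_top
    exact Ideal.mem_minimalPrimes_of_krullDimLE_zero _
  rw [h, hz, mv_height K s p inferInstance, hcard, add_zero]

/-- height via quotients by minimal primes -/
theorem height_of_minimal {A : Type*} [CommRing A] [IsNoetherianRing A] (m : Ideal A) [m.IsPrime]
    (n : ℕ)
    (H : ∀ q : Ideal A, q ∈ minimalPrimes A → q ≤ m → (m.map (Ideal.Quotient.mk q)).height = n) :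
    m.height = n := by
  have key : ∀ q : Ideal A, ∀ p : Ideal A, p.IsPrime → q ≤ p →
      (p.map (Ideal.Quotient.mk q)).IsPrime := fun q p _ hq =>
    Ideal.map_isPrime_of_surjective Ideal.Quotient.mk_surjective (by rwa [Ideal.mk_ker])
  have hc : ∀ q : Ideal A, ∀ p : Ideal A, q ≤ p →
      (p.map (Ideal.Quotient.mk q)).comap (Ideal.Quotient.mk q) = p := by
    intro q p hq
    rw [Ideal.comap_map_of_surjective _ Ideal.Quotient.mk_surjective, ← RingHom.ker_eq_comap_bot,
      Ideal.mk_ker, sup_eq_left.2 hq]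
  apply le_antisymm
  · obtain ⟨l, hl, hlen⟩ := m.exists_ltSeries_length_eq_height
    obtain ⟨q, hq, hql⟩ := Ideal.exists_minimalPrimes_le (I := ⊥) (J := l.head.asIdeal) bot_le
    have hge : ∀ i, q ≤ (l i).asIdeal := fun i => hql.trans (l.head_le i)
    have hlast : l.last.asIdeal = m := by rw [hl]
    have hqm : q ≤ m := hlast ▸ hge (Fin.last _)
    have := key q m ‹_› hqm
    rw [← H q hq hqm, ← hlen]
    let l' : LTSeries (PrimeSpectrum (A ⧸ q)) :=
      LTSeries.mk l.length (fun i => ⟨(l i).asIdeal.map (Ideal.Quotient.mk q),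
        key q _ (l i).isPrime (hge i)⟩) (by
          intro a b hab
          have h := l.strictMono hab
          refine lt_of_le_of_ne (Ideal.map_mono h.le) ?_
          intro he
          have he' := congrArg (fun z => z.asIdeal.comap (Ideal.Quotient.mk q)) he
          simp only [hc q _ (hge a), hc q _ (hge b)] at he'
          exact h.ne (PrimeSpectrum.ext he'))
    have h3 := Order.length_le_height_last (p := l')
    rw [← PrimeSpectrum.height_eq_orderHeight] at h3
    change (l.length : ℕ∞) ≤ (l.last.asIdeal.map (Ideal.Quotient.mk q)).height at h3
    rwa [hlast] at h3
  · obtain ⟨q, hq, hqm⟩ := Ideal.exists_minimalPrimes_le (I := ⊥) (J := m) bot_le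
    have := key q m ‹_› hqm
    rw [← H q hq hqm]
    have h3 := Order.height_le_height_apply_of_strictMono
      (PrimeSpectrum.comap (Ideal.Quotient.mk q)) (Monotone.strictMono_of_injective
        (fun a b h => Ideal.comap_mono h)
        (PrimeSpectrum.comap_injective_of_surjective _ Ideal.Quotient.mk_surjective))
      ⟨m.map (Ideal.Quotient.mk q), this⟩
    rw [← PrimeSpectrum.height_eq_orderHeight, ← PrimeSpectrum.height_eq_orderHeight] at h3
    simpa [hc q m hqm] using h3

theorem nzd_group {F M G : Type*} [Field F] [Group M] [UniqueProds M] [CommGroup G]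
    (φ : M →* G) (hφ : Function.Injective φ) (a c : MonoidAlgebra F G) (ha : a ≠ 0)
    (hs : ∀ g, a.coeff g ≠ 0 → g ∈ Set.range φ) (h : a * c = 0) : c = 0 := by
  classical
  by_contra hc
  have ha' : a.coeff ≠ 0 := by simpa using ha
  have hc' : c.coeff ≠ 0 := by simpa using hc
  obtain ⟨g, hg⟩ := Finsupp.ne_iff.1 ha'
  obtain ⟨b, hb⟩ := Finsupp.ne_iff.1 hc'
  obtain ⟨g', rfl⟩ := hs g hg
  have hφb : Function.Injective (fun x => φ x * b) := fun x y hxy => hφ (mul_right_cancel hxy)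
  obtain ⟨x, hx, y, hy, hu⟩ := UniqueProds.uniqueMul_of_nonempty
    (A := a.coeff.support.preimage φ hφ.injOn)
    (B := c.coeff.support.preimage (fun x => φ x * b) hφb.injOn)
    ⟨g', by simpa using hg⟩ ⟨1, by simpa using hb⟩
  have hU : UniqueMul a.coeff.support c.coeff.support (φ x) (φ y * b) := by
    intro u v hu' hv' huv
    obtain ⟨u', rfl⟩ := hs u (by simpa using hu')
    obtain rfl : v = φ (u'⁻¹ * x * y) * b := by
      have : v = (φ u')⁻¹ * (φ x * (φ y * b)) := by rw [← huv]; group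
      rw [this]; simp [mul_assoc]
    have := @hu u' (u'⁻¹ * x * y) (by simpa using hu') (by simpa using hv') (by group)
    rw [this.1]
    simp
  have h1 := MonoidAlgebra.coeff_mul_mul_of_uniqueMul hU
  rw [h] at h1
  have h2 : a.coeff (φ x) ≠ 0 := by simpa using hx
  have h3 : c.coeff (φ y * b) ≠ 0 := by simpa using hy
  exact mul_ne_zero h2 h3 (by simpa using h1.symm)

theorem aeval_nzd {F P G ι : Type*} [Field F] [CommMonoid P] [CommGroup G] (j : P →* G)
    (hj : Function.Injective j) (x : ι → P)
    (hx : LinearIndependent ℤ (fun i => Additive.ofMul (j (x i))))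
    (f : MvPolynomial ι F) (hf : f ≠ 0) :
    MvPolynomial.aeval (fun i => MonoidAlgebra.of F P (x i)) f ∈
      nonZeroDivisors (MonoidAlgebra F P) := by
  classical
  let φ : Multiplicative (ι →₀ ℤ) →* G := AddMonoidHom.toMultiplicativeLeft
    (Finsupp.linearCombination ℤ (fun i => Additive.ofMul (j (x i)))).toAddMonoidHom
  have hφ : Function.Injective φ := hx
  let J : MonoidAlgebra F P →+* MonoidAlgebra F G := MonoidAlgebra.mapDomainRingHom F j
  have hJ : Function.Injective J := MonoidAlgebra.mapDomain_injective hj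
  let θ : (ι →₀ ℕ) → G := fun d => d.prod fun i n => j (x i) ^ n
  have hθ : ∀ d, θ d = φ (Multiplicative.ofAdd (d.mapRange (Nat.cast : ℕ → ℤ) rfl)) := by
    intro d
    apply Additive.ofMul.injective
    change _ = Finsupp.linearCombination ℤ (fun i => Additive.ofMul (j (x i))) _
    rw [toAdd_ofAdd, Finsupp.linearCombination_apply, Finsupp.sum_mapRange_index (by simp)]
    simp [θ, Finsupp.prod, Finsupp.sum, ofMul_prod]
  have hθinj : Function.Injective θ := by
    intro d e hde
    rw [hθ, hθ] at hde
    exact Finsupp.mapRange_injective _ rfl Nat.cast_injective (hφ hde)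
  have hsum : J (MvPolynomial.aeval (fun i => MonoidAlgebra.of F P (x i)) f) =
      ∑ d ∈ f.support, MonoidAlgebra.single (θ d) (f.coeff d) := by
    conv_lhs => rw [f.as_sum]
    simp only [map_sum, MvPolynomial.aeval_monomial]
    refine Finset.sum_congr rfl fun d _ => ?_
    have h1 : (d.prod fun i k => (MonoidAlgebra.of F P (x i)) ^ k) =
        MonoidAlgebra.of F P (d.prod fun i k => x i ^ k) := by
      simp only [Finsupp.prod, map_prod, map_pow]
    have h2 : θ d = j (d.prod fun i k => x i ^ k) := by
      simp only [θ, Finsupp.prod, map_prod, map_pow]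
    rw [h1, h2]
    simp [J, MonoidAlgebra.of_apply, MonoidAlgebra.mapDomain_single, MonoidAlgebra.single_mul_single,
      MonoidAlgebra.mapDomainRingHom]
  have hcoeff : ∀ g, (J (MvPolynomial.aeval (fun i => MonoidAlgebra.of F P (x i)) f)).coeff g =
      ∑ d ∈ f.support, if θ d = g then f.coeff d else 0 := by
    intro g
    rw [hsum]
    simp [MonoidAlgebra.coeff_sum, Finsupp.single_apply, MonoidAlgebra.coeff_single]
  rw [mem_nonZeroDivisors_iff_right]
  intro c hc
  apply hJ
  rw [map_zero]
  refine nzd_group φ hφ (J (MvPolynomial.aeval (fun i => MonoidAlgebra.of F P (x i)) f)) _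
    ?_ ?_ (by rw [← map_mul, mul_comm, hc, map_zero])
  · obtain ⟨d, hd⟩ := MvPolynomial.ne_zero_iff.1 hf
    intro h0
    have := hcoeff (θ d)
    rw [h0] at this
    simp only [hθinj.eq_iff] at this
    simp only [Finset.sum_ite_eq'] at this
    rw [if_pos (by simpa using hd)] at this
    exact hd (by simpa using this.symm)
  · intro g hg
    rw [hcoeff] at hg
    obtain ⟨d, _, hd⟩ := Finset.exists_ne_zero_of_sum_ne_zero hg
    have : θ d = g := by
      by_contra h; simp [h] at hd
    exact ⟨_, (hθ d).symm.trans this⟩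

theorem exists_basis {P G V : Type*} [CommMonoid P] (hfg : Monoid.FG P) [CommGroup G] (j : P →* G)
    (hjgen : ∀ g : G, ∃ a b : P, g = j a * (j b)⁻¹) [AddCommGroup V] [Module ℚ V]
    (L : Additive G →+ V) (hL : Submodule.span ℚ (Set.range L) = ⊤)
    (hL0 : ∀ g, L g = 0 → ∃ c : ℤ, c ≠ 0 ∧ c • g = 0) :
    ∃ (n : ℕ) (x : Fin n → P), n = Module.finrank ℚ V ∧
      LinearIndependent ℤ (fun i => Additive.ofMul (j (x i))) ∧
      ∀ p : P, ∃ n > 0, ∃ a b : P, a ∈ Submonoid.closure (Set.range x) ∧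
        b ∈ Submonoid.closure (Set.range x) ∧ j p ^ n * j a = j b := by
  classical
  obtain ⟨S, hS⟩ := hfg.1
  let v : P → V := fun p => L (Additive.ofMul (j p))
  obtain ⟨b, hbS, hspan, hli⟩ := exists_linearIndependent ℚ (v '' (S : Set P))
  have hbfin : b.Finite := (S.finite_toSet.image v).subset hbS
  have htop : Submodule.span ℚ b = ⊤ := by
    rw [hspan]
    have h1 : ∀ p : P, v p ∈ Submodule.span ℚ (v '' (S : Set P)) := by
      intro p
      have hp : p ∈ Submonoid.closure (S : Set P) := hS ▸ Submonoid.mem_top p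
      induction hp using Submonoid.closure_induction with
      | mem p hp => exact Submodule.subset_span ⟨p, hp, rfl⟩
      | one => simp [v]
      | mul p q _ _ hp hq =>
        have : v (p * q) = v p + v q := by simp [v]
        rw [this]; exact add_mem hp hq
    rw [eq_top_iff, ← hL, Submodule.span_le]
    rintro _ ⟨g, rfl⟩
    obtain ⟨p, q, hpq⟩ := hjgen g.toMul
    have hg : g = Additive.ofMul (j p) - Additive.ofMul (j q) := by
      rw [← ofMul_div, div_eq_mul_inv, ← hpq]; rfl
    rw [hg, map_sub]
    exact sub_mem (h1 p) (h1 q)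
  have : Finite b := hbfin
  have : Fintype b := hbfin.fintype
  let B : Module.Basis b ℚ V := Module.Basis.mk hli (by simp [htop])
  let e := Fintype.equivFin b
  have hch : ∀ y : b, ∃ p : P, v p = y := fun y => by
    obtain ⟨p, _, hp⟩ := hbS y.2; exact ⟨p, hp⟩
  choose w hw using hch
  have hB : ∀ i, (B.reindex e) i = v (w (e.symm i)) := by
    intro i; simp [B, hw]
  refine ⟨Fintype.card b, fun i => w (e.symm i), (Module.finrank_eq_card_basis B).symm, ?_, ?_⟩
  · have h1 : LinearIndependent ℤ (B.reindex e) :=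
      (B.reindex e).linearIndependent.restrict_scalars (by
        intro a b h; simpa using h)
    refine LinearIndependent.of_comp L.toIntLinearMap ?_
    convert h1 using 1
    ext i
    rw [hB]; rfl
  · intro p
    set y : Fin (Fintype.card b) → P := fun i => w (e.symm i) with hy
    obtain ⟨D, hD⟩ := IsLocalization.exist_integer_multiples_of_finite (nonZeroDivisors ℤ)
      (fun i => (B.reindex e).repr (v p) i)
    choose z hz using hD
    have h1 : L ((D : ℤ) • Additive.ofMul (j p) - ∑ i, z i • Additive.ofMul (j (y i))) = 0 := by
      rw [map_sub, sub_eq_zero, map_zsmul, map_sum]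
      simp only [map_zsmul]
      change (D : ℤ) • v p = ∑ i, z i • v (y i)
      conv_lhs => rw [← (B.reindex e).sum_repr (v p)]
      rw [Finset.smul_sum]
      refine Finset.sum_congr rfl fun i _ => ?_
      have := hz i
      rw [hB, ← smul_assoc]
      change ((D : ℤ) • ((B.reindex e).repr (v p)) i) • v (y i) = _
      have h2 : ((D : ℤ) • ((B.reindex e).repr (v p)) i) = (z i : ℚ) := by
        rw [← this]; rfl
      rw [h2, Int.cast_smul_eq_zsmul]
    obtain ⟨c, hc0, hc⟩ := hL0 _ h1
    have hN0 : c * D ≠ 0 := mul_ne_zero hc0 (nonZeroDivisors.coe_ne_zero D)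
    have h3 : j p ^ (c * (D : ℤ)) = ∏ i, j (y i) ^ (c * z i) := by
      apply Additive.ofMul.injective
      rw [ofMul_prod]
      simp only [ofMul_zpow, mul_smul]
      rw [smul_sub, sub_eq_zero] at hc
      rw [hc, Finset.smul_sum]
    obtain ⟨N, hN, u, hu⟩ : ∃ N : ℕ, 0 < N ∧ ∃ u : Fin (Fintype.card b) → ℤ,
        j p ^ N = ∏ i, j (y i) ^ (u i) := by
      refine ⟨(c * D).natAbs, Int.natAbs_pos.2 hN0, ?_⟩
      rcases Int.natAbs_eq (c * D) with h | h
      · refine ⟨fun i => c * z i, ?_⟩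
        rw [← h3, ← zpow_natCast, ← h]
      · refine ⟨fun i => -(c * z i), ?_⟩
        simp only [zpow_neg, Finset.prod_inv_distrib]
        rw [← h3, ← zpow_natCast, ← zpow_neg]
        congr 1
        omega
    refine ⟨N, hN, ∏ i, y i ^ (-u i).toNat, ∏ i, y i ^ (u i).toNat, ?_, ?_, ?_⟩
    · exact Submonoid.prod_mem _ fun i _ =>
        Submonoid.pow_mem _ (Submonoid.subset_closure (Set.mem_range_self i)) _
    · exact Submonoid.prod_mem _ fun i _ =>
        Submonoid.pow_mem _ (Submonoid.subset_closure (Set.mem_range_self i)) _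
    · rw [hu, map_prod, map_prod, ← Finset.prod_mul_distrib]
      refine Finset.prod_congr rfl fun i _ => ?_
      rw [map_pow, map_pow, ← zpow_natCast, ← zpow_natCast, ← zpow_add]
      congr 1
      omega

theorem exists_basis' {P G : Type*} [CommMonoid P] (hfg : Monoid.FG P) [CommGroup G] (j : P →* G)
    (hjgen : ∀ g : G, ∃ a b : P, g = j a * (j b)⁻¹) :
    ∃ (n : ℕ) (x : Fin n → P), n = Module.finrank ℚ (TensorProduct ℤ ℚ (Additive G)) ∧
      LinearIndependent ℤ (fun i => Additive.ofMul (j (x i))) ∧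
      ∀ p : P, ∃ n > 0, ∃ a b : P, a ∈ Submonoid.closure (Set.range x) ∧
        b ∈ Submonoid.closure (Set.range x) ∧ j p ^ n * j a = j b := by
  refine exists_basis hfg j hjgen (TensorProduct.mk ℤ ℚ (Additive G) 1).toAddMonoidHom ?_ ?_
  · rw [eq_top_iff]
    rintro t -
    induction t using TensorProduct.induction_on with
    | zero => exact zero_mem _
    | add s t hs ht => exact add_mem hs ht
    | tmul r g =>
      have : TensorProduct.tmul ℤ r g = r • TensorProduct.tmul ℤ (1 : ℚ) g := by
        rw [TensorProduct.smul_tmul', smul_eq_mul, mul_one]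
      rw [this]
      exact Submodule.smul_mem _ _ (Submodule.subset_span ⟨g, rfl⟩)
  · intro g hg
    have hloc : IsLocalizedModule (nonZeroDivisors ℤ) (TensorProduct.mk ℤ ℚ (Additive G) 1) :=
      inferInstance
    obtain ⟨c, hc⟩ := (IsLocalizedModule.eq_zero_iff (nonZeroDivisors ℤ)
      (TensorProduct.mk ℤ ℚ (Additive G) 1)).1 hg
    exact ⟨c, nonZeroDivisors.coe_ne_zero c, hc⟩

theorem trbasis {F P G : Type*} [Field F] [CancelCommMonoid P]
    [CommGroup G] (j : P →* G) (hjinj : Function.Injective j) {n : ℕ} (x : Fin n → P)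
    (hx : LinearIndependent ℤ (fun i => Additive.ofMul (j (x i))))
    (hp : ∀ p : P, ∃ n > 0, ∃ a b : P, a ∈ Submonoid.closure (Set.range x) ∧
        b ∈ Submonoid.closure (Set.range x) ∧ j p ^ n * j a = j b)
    (q : Ideal (MonoidAlgebra F P)) (hq : q ∈ minimalPrimes (MonoidAlgebra F P)) :
    IsTranscendenceBasis F
      (fun i => Ideal.Quotient.mk q (MonoidAlgebra.of F P (x i))) := by
  have hqp : q.IsPrime := hq.1.1
  have hdis := Set.disjoint_left.mp (Ideal.disjoint_nonZeroDivisors_of_mem_minimalPrimes hq)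
  have hof : ∀ p : P, MonoidAlgebra.of F P p ∉ q := by
    intro p hpq
    refine hdis hpq ?_
    rw [SetLike.mem_coe, mem_nonZeroDivisors_iff_right]
    intro c hc
    ext s
    have := congrArg (fun z => z.coeff (s * p)) hc
    simpa [MonoidAlgebra.of_apply] using this
  have hind : AlgebraicIndependent F
      (fun i => Ideal.Quotient.mk q (MonoidAlgebra.of F P (x i))) := by
    rw [algebraicIndependent_iff]
    intro f hf
    by_contra hf0
    refine hdis ?_ (aeval_nzd j hjinj x hx f hf0)
    rw [SetLike.mem_coe, ← Ideal.Quotient.eq_zero_iff_mem, ← hf]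
    exact (MvPolynomial.aeval_algebraMap_apply _ _ _).symm
  rw [hind.isTranscendenceBasis_iff_isAlgebraic]
  set R := Algebra.adjoin F
    (Set.range fun i => Ideal.Quotient.mk q (MonoidAlgebra.of F P (x i))) with hR
  have hmem : ∀ a ∈ Submonoid.closure (Set.range x),
      Ideal.Quotient.mk q (MonoidAlgebra.of F P a) ∈ R := by
    intro a ha
    induction ha using Submonoid.closure_induction with
    | mem a ha =>
      obtain ⟨i, rfl⟩ := ha
      exact Algebra.subset_adjoin ⟨i, rfl⟩
    | one => rw [map_one, map_one]; exact R.one_mem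
    | mul a b _ _ ha hb => rw [map_mul, map_mul]; exact R.mul_mem ha hb
  have halg : ∀ p : P, IsAlgebraic R (Ideal.Quotient.mk q (MonoidAlgebra.of F P p)) := by
    intro p
    obtain ⟨k, hk, a, b, ha, hb, hab⟩ := hp p
    have hab' : p ^ k * a = b := hjinj (by simpa using hab)
    let u : R := ⟨_, hmem a ha⟩
    let t : R := ⟨_, hmem b hb⟩
    have hu : u ≠ 0 := by
      intro h
      have h' := congrArg Subtype.val h
      exact hof a (Ideal.Quotient.eq_zero_iff_mem.1 h')
    refine ⟨Polynomial.C u * Polynomial.X ^ k - Polynomial.C t, ?_, ?_⟩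
    · intro h
      have := congrArg (fun z => z.coeff k) h
      simp [Polynomial.coeff_C, hk.ne'] at this
      exact hu this
    · simp only [map_sub, map_mul, map_pow, Polynomial.aeval_C, Polynomial.aeval_X]
      change Ideal.Quotient.mk q (MonoidAlgebra.of F P a) * _ -
        Ideal.Quotient.mk q (MonoidAlgebra.of F P b) = 0
      rw [← hab', map_mul, map_mul, map_pow, map_pow]
      ring
  constructor
  intro y
  obtain ⟨y, rfl⟩ := Ideal.Quotient.mk_surjective y
  induction y using MonoidAlgebra.induction_on with
  | of p => exact halg p
  | add a b ha hb => rw [map_add]; exact ha.add hb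
  | smul r a ha =>
    have h1 : IsAlgebraic R (Ideal.Quotient.mk q (algebraMap F (MonoidAlgebra F P) r)) :=
      isAlgebraic_algebraMap (⟨Ideal.Quotient.mk q (algebraMap F (MonoidAlgebra F P) r),
        R.algebraMap_mem r⟩ : R)
    rw [Algebra.smul_def, map_mul]
    exact h1.mul ha


/-- Let `F` be a field and `P` a fine monoid.  For every maximal ideal `m` of the monoid
algebra `F[P]`, the Krull dimension of the localization `F[P]_m` equals the rank of the
groupification `P^gp` (realized here by any group `G` receiving `P` by an injective map
generating `G` by fractions); the rank is `dim_ℚ (ℚ ⊗_ℤ G)`. -/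
theorem stmt14 {F P G : Type*} [Field F] [CancelCommMonoid P] (hfg : Monoid.FG P)
    [CommGroup G] (j : P →* G) (hjinj : Function.Injective j)
    (hjgen : ∀ g : G, ∃ a b : P, g = j a * (j b)⁻¹)
    (m : Ideal (MonoidAlgebra F P)) (hm : m.IsMaximal) :
    letI := hm.isPrime
    ringKrullDim (Localization.AtPrime m) =
      (Module.finrank ℚ (TensorProduct ℤ ℚ (Additive G)) : WithBot (WithTop ℕ)) := by
  have hprime : m.IsPrime := hm.isPrime
  obtain ⟨n, x, hn, hx, hp⟩ := exists_basis' hfg j hjgen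
  have hft : Algebra.FiniteType F (MonoidAlgebra F P) := MonoidAlgebra.finiteType_iff_fg.2 hfg
  have hnoeth : IsNoetherianRing (MonoidAlgebra F P) :=
    Algebra.FiniteType.isNoetherianRing F _
  rw [IsLocalization.AtPrime.ringKrullDim_eq_height m, ← hn]
  rw [height_of_minimal m n]
  · rfl
  · intro q hq hqm
    have hqp : q.IsPrime := hq.1.1
    have := height_of_trbasis _ (trbasis j hjinj x hx hp q hq) (m.map (Ideal.Quotient.mk q))
      (Ideal.IsMaximal.map_of_surjective_of_ker_le Ideal.Quotient.mk_surjective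
        (by rwa [Ideal.mk_ker]))
    simpa using this
end
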